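/- Let (R,P) be a commutative Noetherian local ring, I an ideal of R, M and N finitely generated R-modules, and i ≥ 0. Assume that the ideal I + ann_R M + ann_R N is P-primary. Then there exist a polynomial p ∈ ℚ[x] and an integer n₀ such that length_R(Tor_i^R(M/I^n M, N/I^n N)) = p(n) for all n ≥ n₀. -/

import Mathlib

open CategoryTheory IsLocalRing

/-- `Tor_i^R(M, N)` as an object of `ModuleCat R`. -/
noncomputable def TorM (R : Type) [CommRing R] (i : ℕ)
    (M : Type) [AddCommGroup M] [Module R M]
    (N : Type) [AddCommGroup N] [Module R N] : ModuleCat R :=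
  ((Tor (ModuleCat R) i).obj (ModuleCat.of R M)).obj (ModuleCat.of R N)

/-- The length of a module: the Krull dimension of its lattice of submodules. -/
noncomputable def modLength (R : Type) [CommRing R]
    (M : Type) [AddCommGroup M] [Module R M] : WithBot ℕ∞ :=
  Order.krullDim (Submodule R M)

section GradedFamilies

variable {R : Type} [CommRing R] {G σ : Type} {sh : σ → G → G}
  {X : G → Type} [∀ g, AddCommGroup (X g)] [∀ g, Module R (X g)]
  {X' : G → Type} [∀ g, AddCommGroup (X' g)] [∀ g, Module R (X' g)]

/-- A family of submodules stable under the operators indexed by `S`. -/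
def StableOn (op : ∀ s g, X g →ₗ[R] X (sh s g)) (S : Set σ) (Z : ∀ g, Submodule R (X g)) : Prop :=
  ∀ s ∈ S, ∀ g, ∀ z ∈ Z g, op s g z ∈ Z (sh s g)

/-- A family of submodules stable under all operators. -/
def Stable (op : ∀ s g, X g →ₗ[R] X (sh s g)) (Z : ∀ g, Submodule R (X g)) : Prop :=
  ∀ s g, ∀ z ∈ Z g, op s g z ∈ Z (sh s g)

/-- Ascending chain condition on stable families of submodules. -/
def Noe (op : ∀ s g, X g →ₗ[R] X (sh s g)) : Prop :=
  WellFoundedGT {Z : ∀ g, Submodule R (X g) // Stable op Z}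

/-- Finite generation of a family with operators. -/
def FG (op : ∀ s g, X g →ₗ[R] X (sh s g)) : Prop :=
  ∃ (K : Type) (_ : Finite K) (d : K → G) (e : ∀ k, X (d k)),
    ∀ Z : ∀ g, Submodule R (X g), Stable op Z → (∀ k, e k ∈ Z (d k)) → ∀ g, Z g = ⊤

/-- The operators commute with each other. -/
def OpComm [DecidableEq G] (op : ∀ s g, X g →ₗ[R] X (sh s g)) : Prop :=
  ∀ s t g x, DirectSum.lof R G X _ (op s _ (op t g x)) = DirectSum.lof R G X _ (op t _ (op s g x))

variable {op : ∀ s g, X g →ₗ[R] X (sh s g)} {op' : ∀ s g, X' g →ₗ[R] X' (sh s g)}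

theorem Noe.of_injective (h : Noe op') (f : ∀ g, X g →ₗ[R] X' g)
    (hf : ∀ g, Function.Injective (f g)) (hc : ∀ s g x, f _ (op s g x) = op' s g (f g x)) :
    Noe op := by
  unfold Noe at *
  let F : {Z : ∀ g, Submodule R (X g) // Stable op Z} →
      {Z : ∀ g, Submodule R (X' g) // Stable op' Z} := fun Z =>
    ⟨fun g => (Z.1 g).map (f g), by
      rintro s g _ ⟨z, hz, rfl⟩
      exact ⟨_, Z.2 s g z hz, hc s g z⟩⟩
  have hF : StrictMono F := by
    apply Monotone.strictMono_of_injective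
    · intro Z Z' hZ g
      exact Submodule.map_mono (hZ g)
    · intro Z Z' hZ
      apply Subtype.ext
      funext g
      have := congrFun (congrArg Subtype.val hZ) g
      exact Submodule.map_injective_of_injective (hf g) this
  exact hF.wellFoundedGT

theorem FG.of_surjective (h : FG op) (f : ∀ g, X g →ₗ[R] X' g)
    (hf : ∀ g, Function.Surjective (f g)) (hc : ∀ s g x, f _ (op s g x) = op' s g (f g x)) :
    FG op' := by
  obtain ⟨K, hK, d, e, he⟩ := h
  refine ⟨K, hK, d, fun k => f _ (e k), fun Z hZ hk g => ?_⟩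
  have := he (fun g => (Z g).comap (f g)) (by
    intro s g z hz
    simp only [Submodule.mem_comap] at hz ⊢
    rw [hc]
    exact hZ s g _ hz) hk g
  rw [eq_top_iff]
  intro y _
  obtain ⟨x, rfl⟩ := hf g y
  have hx : x ∈ (Z g).comap (f g) := this ▸ trivial
  exact hx

/-- The smallest stable family of submodules containing a given one. -/
def stableClosure (op : ∀ s g, X g →ₗ[R] X (sh s g)) (S : ∀ g, Set (X g)) :
    {Z : ∀ g, Submodule R (X g) // Stable op Z} :=
  ⟨fun g => sInf {N | ∃ Z : ∀ g, Submodule R (X g), Stable op Z ∧ (∀ g, S g ⊆ Z g) ∧ N = Z g}, by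
    intro s g z hz
    simp only [Submodule.mem_sInf, Set.mem_ofPred_eq, forall_exists_index, and_imp] at hz ⊢
    rintro _ Z hZ hS rfl
    exact hZ s g z (hz _ Z hZ hS rfl)⟩

theorem subset_stableClosure (S : ∀ g, Set (X g)) (g : G) :
    S g ⊆ (stableClosure op S).1 g := by
  intro x hx
  simp only [stableClosure, SetLike.mem_coe, Submodule.mem_sInf, Set.mem_ofPred_eq,
    forall_exists_index, and_imp]
  rintro _ Z _ hS rfl
  exact hS g hx

theorem stableClosure_le (S : ∀ g, Set (X g)) {Z : ∀ g, Submodule R (X g)} (hZ : Stable op Z)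
    (hS : ∀ g, S g ⊆ Z g) (g : G) : (stableClosure op S).1 g ≤ Z g :=
  sInf_le ⟨Z, hZ, hS, rfl⟩

theorem Noe.fg (h : Noe op) : FG op := by
  classical
  let S : Finset (Σ g, X g) → ∀ g, Set (X g) := fun F g => {x | (⟨g, x⟩ : Σ g, X g) ∈ F}
  obtain ⟨F, -, hM⟩ := (InvImage.wf (fun F => stableClosure op (S F)) h.wf).has_min
    Set.univ ⟨∅, trivial⟩
  have htop : ∀ g, (stableClosure op (S F)).1 g = ⊤ := by
    intro g
    rw [eq_top_iff]
    intro x _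
    by_contra hx
    have hS : ∀ g', S F g' ⊆ S (insert ⟨g, x⟩ F) g' := fun g' y hy =>
      Finset.mem_insert_of_mem (s := F) hy
    have hxS : x ∈ S (insert ⟨g, x⟩ F) g := Finset.mem_insert_self _ F
    generalize insert ⟨g, x⟩ F = F' at hS hxS
    have hle : stableClosure op (S F) ≤ stableClosure op (S F') := fun g' =>
      stableClosure_le _ (stableClosure op (S F')).2 (fun g'' y hy =>
        subset_stableClosure (S F') g'' (hS g'' hy)) g'
    have hlt : stableClosure op (S F) < stableClosure op (S F') :=
      lt_of_le_not_ge hle fun hge => hx (hge g (subset_stableClosure (S F') g hxS))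
    exact hM F' trivial hlt
  refine ⟨F, inferInstance, fun k => k.1.1, fun k => k.1.2, fun Z hZ hk g => ?_⟩
  have hle := stableClosure_le (op := op) (S F) hZ (fun g x hx => hk ⟨⟨g, x⟩, hx⟩) g
  rw [eq_top_iff, ← htop g]
  exact hle

variable [DecidableEq G]

/-- The operator on the direct sum induced by a family of operators. -/
noncomputable def totalOp (op : ∀ s g, X g →ₗ[R] X (sh s g)) (s : σ) :
    Module.End R (DirectSum G X) :=
  DirectSum.toModule R G _ (fun g => DirectSum.lof R G X (sh s g) ∘ₗ op s g)

@[simp] theorem totalOp_lof (s : σ) (g : G) (x : X g) :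
    totalOp op s (DirectSum.lof R G X g x) = DirectSum.lof R G X _ (op s g x) := by
  simp [totalOp]

theorem totalOp_comm (hc : OpComm op) (s t : σ) :
    totalOp op s * totalOp op t = totalOp op t * totalOp op s := by
  apply DirectSum.linearMap_ext
  intro g
  ext1 x
  simpa using hc s t g x

/-- The submodule of the direct sum attached to a family of submodules. -/
def totalSub (Z : ∀ g, Submodule R (X g)) : Submodule R (DirectSum G X) where
  carrier := {t | ∀ g, t g ∈ Z g}
  add_mem' := fun ha hb g => by simpa using (Z g).add_mem (ha g) (hb g)
  zero_mem' := fun g => by simp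
  smul_mem' := fun c x hx g => (Z g).smul_mem c (hx g)

theorem lof_mem_totalSub {Z : ∀ g, Submodule R (X g)} {g : G} {x : X g} :
    DirectSum.lof R G X g x ∈ totalSub Z ↔ x ∈ Z g := by
  constructor
  · intro h
    have := h g
    rwa [DirectSum.lof_apply] at this
  · intro hx g'
    by_cases h : g = g'
    · subst h
      rwa [DirectSum.lof_apply]
    · rw [DirectSum.lof_eq_of, DirectSum.of_eq_of_ne _ _ _ (Ne.symm h)]
      exact zero_mem _

theorem totalOp_mem {Z : ∀ g, Submodule R (X g)} (hZ : Stable op Z) (s : σ)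
    {t : DirectSum G X} (ht : t ∈ totalSub Z) : totalOp op s t ∈ totalSub Z := by
  classical
  rw [← DirectSum.sum_support_of t, map_sum]
  refine sum_mem fun g _ => ?_
  rw [← DirectSum.lof_eq_of R, totalOp_lof, lof_mem_totalSub]
  exact hZ s g _ (ht g)

open scoped IsMulCommutative in
theorem FG.noe [IsNoetherianRing R] [Finite σ] (hfg : FG op) (hc : OpComm op) : Noe op := by
  obtain ⟨K, hK, d, e, he⟩ := hfg
  let A := Algebra.adjoin R (Set.range (totalOp op))
  have : IsMulCommutative A := Algebra.isMulCommutative_adjoin R (by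
    rintro _ ⟨s, rfl⟩ _ ⟨t, rfl⟩
    exact totalOp_comm hc s t)
  have : Algebra.FiniteType R A := by
    have h : A.FG := Subalgebra.fg_def.2 ⟨_, Set.finite_range _, rfl⟩
    exact (Subalgebra.fg_iff_finiteType A).1 h
  have : IsNoetherianRing A := Algebra.FiniteType.isNoetherianRing R A
  let N : Submodule A (DirectSum G X) :=
    Submodule.span A (Set.range fun k => DirectSum.lof R G X (d k) (e k))
  have : IsNoetherian A N :=
    isNoetherian_span_of_finite A (Set.finite_range _)
  have hA : ∀ (Z : ∀ g, Submodule R (X g)), Stable op Z → ∀ a ∈ A, ∀ t ∈ totalSub Z,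
      a t ∈ totalSub Z := by
    intro Z hZ a ha
    induction ha using Algebra.adjoin_induction with
    | mem x hx =>
      obtain ⟨s, rfl⟩ := hx
      intro t ht
      exact totalOp_mem hZ s ht
    | algebraMap r =>
      intro t ht
      simpa [Module.algebraMap_end_apply] using (totalSub Z).smul_mem r ht
    | add x y _ _ hx hy =>
      intro t ht
      exact add_mem (hx t ht) (hy t ht)
    | mul x y _ _ hx hy =>
      intro t ht
      exact hx _ (hy t ht)
  have hN : ∀ g x, DirectSum.lof R G X g x ∈ N := by
    let W : ∀ g, Submodule R (X g) := fun g =>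
      { carrier := {x | DirectSum.lof R G X g x ∈ N}
        add_mem' := fun ha hb => by
          simp only [Set.mem_ofPred_eq, map_add] at *
          exact add_mem ha hb
        zero_mem' := by simp
        smul_mem' := fun c x hx => by
          simp only [Set.mem_ofPred_eq, map_smul] at *
          have := N.smul_mem (algebraMap R A c) hx
          exact this }
    intro g x
    have : W g = ⊤ := he W (by
      intro s g z hz
      change DirectSum.lof R G X _ _ ∈ N
      rw [← totalOp_lof]
      exact N.smul_mem (⟨totalOp op s, Algebra.subset_adjoin ⟨s, rfl⟩⟩ : A) hz)
      (fun k => Submodule.subset_span ⟨k, rfl⟩) g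
    exact (this ▸ trivial : x ∈ W g)
  let F : {Z : ∀ g, Submodule R (X g) // Stable op Z} → Submodule A N := fun Z =>
    { carrier := {t | t.1 ∈ totalSub Z.1}
      add_mem' := fun ha hb => (totalSub Z.1).add_mem ha hb
      zero_mem' := zero_mem (totalSub Z.1)
      smul_mem' := fun c x hx => hA Z.1 Z.2 c.1 c.2 x.1 hx }
  have hmem : ∀ Z g x, (⟨_, hN g x⟩ : N) ∈ F Z ↔ x ∈ Z.1 g := fun Z g x => lof_mem_totalSub
  have hF : StrictMono F := by
    apply Monotone.strictMono_of_injective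
    · intro Z Z' hZ t ht g
      exact hZ g (ht g)
    · intro Z Z' hZ
      apply Subtype.ext
      funext g
      ext x
      rw [← hmem, ← hmem, hZ]
  exact hF.wellFoundedGT

end GradedFamilies

section FreeCover

variable {R : Type} [CommRing R] {ι : Type}
  {X : ℕ → Type} [∀ g, AddCommGroup (X g)] [∀ g, Module R (X g)]

/-- The degree shift of an operator of degree one. -/
abbrev sh1 (ι : Type) : ι → ℕ → ℕ := fun _ m => m + 1

/-- The operator on the product of all degrees induced by operators of degree one. -/
def piOp (op : ∀ (s : ι) (m : ℕ), X m →ₗ[R] X (sh1 ι s m)) (s : ι) (t : ∀ m, X m) : ∀ m, X m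
  | 0 => 0
  | m + 1 => op s m (t m)

theorem exists_flat_cover {op : ∀ (s : ι) (m : ℕ), X m →ₗ[R] X (sh1 ι s m)}
    (hfg : FG op) (hc : ∀ s t m x, op s (m + 1) (op t m x) = op t (m + 1) (op s m x)) :
    ∃ (P : ℕ → Type) (_ : ∀ m, AddCommGroup (P m)) (_ : ∀ m, Module R (P m))
      (opP : ∀ (s : ι) (m : ℕ), P m →ₗ[R] P (sh1 ι s m)) (φ : ∀ m, P m →ₗ[R] X m),
      (∀ m, Module.Flat R (P m)) ∧ FG opP ∧
      (∀ s t m x, opP s (m + 1) (opP t m x) = opP t (m + 1) (opP s m x)) ∧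
      (∀ m, Function.Surjective (φ m)) ∧ ∀ s m x, φ (m + 1) (opP s m x) = op s m (φ m x) := by
  obtain ⟨K, hK, d, e, he⟩ := hfg
  classical
  have : LeftCommutative (piOp op) := ⟨by
    intro s t x
    funext m
    match m with
    | 0 => rfl
    | 1 => simp [piOp]
    | m + 2 => exact hc s t m (x m)⟩
  let B : ℕ → Type := fun m => {p : Multiset ι × K // Multiset.card p.1 + d p.2 = m}
  let ev : Multiset ι → K → ∀ m, X m := fun α k =>
    Multiset.foldr (piOp op) (Pi.single (d k) (e k)) α
  let sB : ∀ (s : ι) m, B m → B (m + 1) := fun s m b =>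
    ⟨(s ::ₘ b.1.1, b.1.2), by have := b.2; simp only [Multiset.card_cons]; omega⟩
  let opP : ∀ (s : ι) (m : ℕ), (B m →₀ R) →ₗ[R] (B (m + 1) →₀ R) := fun s m =>
    Finsupp.lmapDomain R R (sB s m)
  let φ : ∀ m, (B m →₀ R) →ₗ[R] X m := fun m =>
    Finsupp.linearCombination R (fun b => ev b.1.1 b.1.2 m)
  have hφ : ∀ s m x, φ (m + 1) (opP s m x) = op s m (φ m x) := by
    intro s m x
    have : (φ (m + 1)) ∘ₗ (opP s m) = (op s m) ∘ₗ (φ m) := by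
      ext b
      simp only [LinearMap.comp_apply, Finsupp.lsingle_apply, φ, opP, Finsupp.lmapDomain_apply,
        Finsupp.mapDomain_single, Finsupp.linearCombination_single, one_smul, ev, sB,
        Multiset.foldr_cons]
      rfl
    exact LinearMap.congr_fun this x
  refine ⟨fun m => B m →₀ R, inferInstance, inferInstance, opP, φ, inferInstance, ?_, ?_, ?_, hφ⟩
  · refine ⟨K, hK, d, fun k => Finsupp.single ⟨(0, k), by simp⟩ 1, fun Z hZ hk => ?_⟩
    have key : ∀ (α : Multiset ι) (k : K) (m : ℕ) (h : Multiset.card α + d k = m),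
        (Finsupp.single (⟨(α, k), h⟩ : B m) (1 : R)) ∈ Z m := by
      intro α
      induction α using Multiset.induction with
      | empty =>
        intro k m h
        obtain rfl : m = d k := by simpa using h.symm
        exact hk k
      | cons s α ih =>
        intro k m h
        obtain rfl : m = (Multiset.card α + d k) + 1 := by
          simp only [Multiset.card_cons] at h; omega
        have := hZ s _ _ (ih k _ rfl)
        simpa [opP, sB] using this
    intro m
    rw [eq_top_iff]
    intro x _
    induction x using Finsupp.induction_linear with
    | zero => exact zero_mem _
    | add f g hf hg => exact add_mem (hf trivial) (hg trivial)
    | single b c =>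
      have := (Z m).smul_mem c (key b.1.1 b.1.2 m b.2)
      simpa using this
  · intro s t m x
    have : (opP s (m + 1)) ∘ₗ (opP t m) = (opP t (m + 1)) ∘ₗ (opP s m) := by
      ext1 b
      ext1
      simp only [LinearMap.comp_apply, Finsupp.lsingle_apply, opP, Finsupp.lmapDomain_apply,
        Finsupp.mapDomain_single, sB]
      congr 1
      apply Subtype.ext
      simp [Multiset.cons_swap]
    exact LinearMap.congr_fun this x
  · intro m
    rw [← LinearMap.range_eq_top]
    refine he (fun m => LinearMap.range (φ m)) ?_ ?_ m
    · rintro s m _ ⟨z, rfl⟩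
      exact ⟨opP s m z, hφ s m z⟩
    · intro k
      refine ⟨Finsupp.single ⟨(0, k), by simp⟩ 1, ?_⟩
      simp [φ, ev]

end FreeCover

section Bigraded

variable {R : Type} [CommRing R] {ι κ : Type}

/-- The bidegree shift of operators of bidegree `(1, 0)` and `(0, 1)`. -/
abbrev sh2 (ι κ : Type) : ι ⊕ κ → ℕ × ℕ → ℕ × ℕ
  | .inl _, g => (g.1 + 1, g.2)
  | .inr _, g => (g.1, g.2 + 1)

section Tensor
open TensorProduct

variable {X : ℕ → Type} [∀ g, AddCommGroup (X g)] [∀ g, Module R (X g)]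
  {Y : ℕ → Type} [∀ g, AddCommGroup (Y g)] [∀ g, Module R (Y g)]

/-- The operators on the external tensor product of two graded families. -/
noncomputable def tensorOp (opX : ∀ (s : ι) (m : ℕ), X m →ₗ[R] X (sh1 ι s m))
    (opY : ∀ (s : κ) (m : ℕ), Y m →ₗ[R] Y (sh1 κ s m)) :
    ∀ (s : ι ⊕ κ) (g : ℕ × ℕ), (X g.1 ⊗[R] Y g.2) →ₗ[R]
      (X (sh2 ι κ s g).1 ⊗[R] Y (sh2 ι κ s g).2)
  | .inl i, g => (opX i g.1).rTensor (Y g.2)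
  | .inr j, g => (opY j g.2).lTensor (X g.1)

theorem FG.tensor {opX : ∀ (s : ι) (m : ℕ), X m →ₗ[R] X (sh1 ι s m)}
    {opY : ∀ (s : κ) (m : ℕ), Y m →ₗ[R] Y (sh1 κ s m)} (hX : FG opX) (hY : FG opY) :
    FG (X := fun g : ℕ × ℕ => X g.1 ⊗[R] Y g.2) (tensorOp opX opY) := by
  obtain ⟨K, hK, d, e, he⟩ := hX
  obtain ⟨K', hK', d', e', he'⟩ := hY
  refine ⟨K × K', inferInstance, fun k => (d k.1, d' k.2), fun k => e k.1 ⊗ₜ e' k.2, ?_⟩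
  intro Z hZ hk
  have h1 : ∀ l m (x : X m), x ⊗ₜ[R] e' l ∈ Z (m, d' l) := by
    intro l m x
    have := he (fun m => (Z (m, d' l)).comap ((TensorProduct.mk R (X m) (Y (d' l))).flip (e' l)))
      (fun s m z hz => hZ (.inl s) (m, d' l) _ hz) (fun k => hk (k, l)) m
    exact (this ▸ trivial : x ∈ (Z (m, d' l)).comap
      ((TensorProduct.mk R (X m) (Y (d' l))).flip (e' l)))
  have h2 : ∀ m n (x : X m) (y : Y n), x ⊗ₜ[R] y ∈ Z (m, n) := by
    intro m n x y
    have := he' (fun n => (Z (m, n)).comap (TensorProduct.mk R (X m) (Y n) x))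
      (fun s n z hz => hZ (.inr s) (m, n) _ hz) (fun k => h1 k m x) n
    exact (this ▸ trivial : y ∈ (Z (m, n)).comap (TensorProduct.mk R (X m) (Y n) x))
  intro g
  rw [eq_top_iff, ← TensorProduct.span_tmul_eq_top, Submodule.span_le]
  rintro _ ⟨x, y, rfl⟩
  exact h2 _ _ x y

theorem tensorOp_comm {opX : ∀ (s : ι) (m : ℕ), X m →ₗ[R] X (sh1 ι s m)}
    {opY : ∀ (s : κ) (m : ℕ), Y m →ₗ[R] Y (sh1 κ s m)}
    (hX : ∀ s t m x, opX s (m + 1) (opX t m x) = opX t (m + 1) (opX s m x))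
    (hY : ∀ s t m x, opY s (m + 1) (opY t m x) = opY t (m + 1) (opY s m x)) :
    OpComm (X := fun g : ℕ × ℕ => X g.1 ⊗[R] Y g.2) (tensorOp opX opY) := by
  rintro (s | s) (t | t) g x
  · have : (opX s (g.1 + 1)).rTensor (Y g.2) ∘ₗ (opX t g.1).rTensor (Y g.2) =
        (opX t (g.1 + 1)).rTensor (Y g.2) ∘ₗ (opX s g.1).rTensor (Y g.2) := by
      rw [← LinearMap.rTensor_comp, ← LinearMap.rTensor_comp]
      congr 1
      ext x
      exact hX s t _ x
    exact congrArg (DirectSum.lof R (ℕ × ℕ) (fun g : ℕ × ℕ => X g.1 ⊗[R] Y g.2)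
      (g.1 + 1 + 1, g.2)) (LinearMap.congr_fun this x)
  · have : (opX s g.1).rTensor (Y (g.2 + 1)) ∘ₗ (opY t g.2).lTensor (X g.1) =
        (opY t g.2).lTensor (X (g.1 + 1)) ∘ₗ (opX s g.1).rTensor (Y g.2) := by
      ext x y; rfl
    exact congrArg (DirectSum.lof R (ℕ × ℕ) (fun g : ℕ × ℕ => X g.1 ⊗[R] Y g.2)
      (g.1 + 1, g.2 + 1)) (LinearMap.congr_fun this x)
  · have : (opY s g.2).lTensor (X (g.1 + 1)) ∘ₗ (opX t g.1).rTensor (Y g.2) =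
        (opX t g.1).rTensor (Y (g.2 + 1)) ∘ₗ (opY s g.2).lTensor (X g.1) := by
      ext x y; rfl
    exact congrArg (DirectSum.lof R (ℕ × ℕ) (fun g : ℕ × ℕ => X g.1 ⊗[R] Y g.2)
      (g.1 + 1, g.2 + 1)) (LinearMap.congr_fun this x)
  · have : (opY s (g.2 + 1)).lTensor (X g.1) ∘ₗ (opY t g.2).lTensor (X g.1) =
        (opY t (g.2 + 1)).lTensor (X g.1) ∘ₗ (opY s g.2).lTensor (X g.1) := by
      rw [← LinearMap.lTensor_comp, ← LinearMap.lTensor_comp]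
      congr 1
      ext x
      exact hY s t _ x
    exact congrArg (DirectSum.lof R (ℕ × ℕ) (fun g : ℕ × ℕ => X g.1 ⊗[R] Y g.2)
      (g.1, g.2 + 1 + 1)) (LinearMap.congr_fun this x)

end Tensor

variable {X : ℕ × ℕ → Type} [∀ g, AddCommGroup (X g)] [∀ g, Module R (X g)]

/-- The two kinds of operators of a bigraded family commute with each other. -/
def MixedComm (op : ∀ (s : ι ⊕ κ) (g : ℕ × ℕ), X g →ₗ[R] X (sh2 ι κ s g)) : Prop :=
  ∀ i j m n (x : X (m, n)), op (.inl i) (m, n + 1) (op (.inr j) (m, n) x) =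
    op (.inr j) (m + 1, n) (op (.inl i) (m, n) x)

/-- Exchange the two gradings. -/
def swapOp (op : ∀ (s : ι ⊕ κ) (g : ℕ × ℕ), X g →ₗ[R] X (sh2 ι κ s g)) :
    ∀ (s : κ ⊕ ι) (g : ℕ × ℕ), X g.swap →ₗ[R] X (sh2 κ ι s g).swap
  | .inl j, g => op (.inr j) g.swap
  | .inr i, g => op (.inl i) g.swap

theorem Stable.swap {op : ∀ (s : ι ⊕ κ) (g : ℕ × ℕ), X g →ₗ[R] X (sh2 ι κ s g)}
    {Z : ∀ g, Submodule R (X g)} (hZ : Stable op Z) :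
    Stable (X := fun g : ℕ × ℕ => X g.swap) (swapOp op) (fun g => Z g.swap) := by
  rintro (s | s) g z hz
  · exact hZ (.inr s) g.swap z hz
  · exact hZ (.inl s) g.swap z hz

theorem Noe.swap {op : ∀ (s : ι ⊕ κ) (g : ℕ × ℕ), X g →ₗ[R] X (sh2 ι κ s g)} (h : Noe op) :
    Noe (X := fun g : ℕ × ℕ => X g.swap) (swapOp op) := by
  unfold Noe at *
  let F : {Z : ∀ g : ℕ × ℕ, Submodule R (X g.swap) //
      Stable (X := fun g : ℕ × ℕ => X g.swap) (swapOp op) Z} →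
      {Z : ∀ g, Submodule R (X g) // Stable op Z} := fun Z =>
    ⟨fun g => Z.1 g.swap, by
      rintro (s | s) g z hz
      · exact Z.2 (.inr s) g.swap z hz
      · exact Z.2 (.inl s) g.swap z hz⟩
  have hF : StrictMono F := by
    apply Monotone.strictMono_of_injective
    · intro Z Z' hZ g
      exact hZ g.swap
    · intro Z Z' hZ
      apply Subtype.ext
      funext g
      exact congrFun (congrArg Subtype.val hZ) g.swap
  exact hF.wellFoundedGT

theorem MixedComm.swap {op : ∀ (s : ι ⊕ κ) (g : ℕ × ℕ), X g →ₗ[R] X (sh2 ι κ s g)}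
    (h : MixedComm op) : MixedComm (X := fun g : ℕ × ℕ => X g.swap) (swapOp op) :=
  fun i j m n x => (h j i n m x).symm

/-- In a stable subfamily, the subfamily generated by the part of first degree at most `k`. -/
def truncGen (op : ∀ (s : ι ⊕ κ) (g : ℕ × ℕ), X g →ₗ[R] X (sh2 ι κ s g))
    (S : ∀ g, Submodule R (X g)) (k : ℕ) : ∀ m n, Submodule R (X (m, n))
  | 0, n => S (0, n)
  | m + 1, n => if m + 1 ≤ k then S (m + 1, n) else
      ⨆ i, (truncGen op S k m n).map (op (.inl i) (m, n))

theorem Noe.exists_generated {op : ∀ (s : ι ⊕ κ) (g : ℕ × ℕ), X g →ₗ[R] X (sh2 ι κ s g)}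
    (h : Noe op) (hc : MixedComm op) {S : ∀ g, Submodule R (X g)} (hS : Stable op S) :
    ∃ k, ∀ m ≥ k, ∀ n, S (m + 1, n) ≤ ⨆ i, (S (m, n)).map (op (.inl i) (m, n)) := by
  have hle : ∀ k m n, truncGen op S k m n ≤ S (m, n) := by
    intro k m
    induction m with
    | zero => intro n; exact le_rfl
    | succ m ih =>
      intro n
      rw [truncGen]
      split_ifs
      · exact le_rfl
      · refine iSup_le fun i => ?_
        rintro _ ⟨z, hz, rfl⟩
        exact hS (.inl i) (m, n) z (ih n hz)
  have hst : ∀ k, Stable op (fun g => truncGen op S k g.1 g.2) := by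
    rintro k (i | j) ⟨m, n⟩ z hz
    · change _ ∈ truncGen op S k (m + 1) n
      rw [truncGen]
      split_ifs
      · exact hS (.inl i) (m, n) z (hle _ _ _ hz)
      · exact Submodule.mem_iSup_of_mem i ⟨z, hz, rfl⟩
    · change _ ∈ truncGen op S k m (n + 1)
      change z ∈ truncGen op S k m n at hz
      induction m with
      | zero => exact hS (.inr j) (0, n) z hz
      | succ m ih =>
        rw [truncGen] at hz ⊢
        split_ifs at hz ⊢ with hk
        · exact hS (.inr j) _ z hz
        · have hgoal : (⨆ i, (truncGen op S k m n).map (op (.inl i) (m, n))) ≤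
              Submodule.comap (op (.inr j) (m + 1, n))
                (⨆ i, (truncGen op S k m (n + 1)).map (op (.inl i) (m, n + 1))) := by
            refine iSup_le fun i => ?_
            rintro _ ⟨w, hw, rfl⟩
            rw [Submodule.mem_comap, ← hc i j m n w]
            exact Submodule.mem_iSup_of_mem i ⟨op (.inr j) (m, n) w, ih w hw, rfl⟩
          exact hgoal hz
  have hmono : ∀ k m n, truncGen op S k m n ≤ truncGen op S (k + 1) m n := by
    intro k m
    induction m with
    | zero => intro n; exact le_rfl
    | succ m ih =>
      intro n
      by_cases hk : m + 1 ≤ k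
      · rw [truncGen, truncGen, if_pos hk, if_pos (by omega)]
      · by_cases hk' : m + 1 ≤ k + 1
        · conv_rhs => rw [truncGen, if_pos hk']
          exact hle _ _ _
        · rw [truncGen, truncGen, if_neg hk, if_neg hk']
          exact iSup_mono fun i => Submodule.map_mono (ih n)
  let F : ℕ →o {Z : ∀ g, Submodule R (X g) // Stable op Z} :=
    ⟨fun k => ⟨_, hst k⟩, monotone_nat_of_le_succ fun k g => hmono k g.1 g.2⟩
  unfold Noe at h
  obtain ⟨k, hk⟩ := WellFoundedGT.monotone_chain_condition F
  have hfull : ∀ m n, S (m, n) ≤ truncGen op S k m n := by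
    intro m n
    have h1 : truncGen op S k m n = truncGen op S (k + m) m n :=
      congrFun (congrArg Subtype.val (hk (k + m) (by omega))) (m, n)
    rw [h1]
    cases m with
    | zero => exact le_rfl
    | succ m => rw [truncGen, if_pos (by omega)]
  refine ⟨k, fun m hm n => ?_⟩
  refine (hfull (m + 1) n).trans ?_
  rw [truncGen, if_neg (by omega)]
  exact iSup_mono fun i => Submodule.map_mono (hle _ _ _)

theorem Noe.exists_generated' {op : ∀ (s : ι ⊕ κ) (g : ℕ × ℕ), X g →ₗ[R] X (sh2 ι κ s g)}
    (h : Noe op) (hc : MixedComm op) {S : ∀ g, Submodule R (X g)} (hS : Stable op S) :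
    ∃ k, ∀ n ≥ k, ∀ m, S (m, n + 1) ≤ ⨆ j, (S (m, n)).map (op (.inr j) (m, n)) :=
  Noe.exists_generated h.swap hc.swap hS.swap

end Bigraded

section EventuallyPolynomial

/-- Sequences of rational numbers which eventually agree with a polynomial. -/
def eventuallyPoly : Submodule ℚ (ℕ → ℚ) where
  carrier := {g | ∃ (p : Polynomial ℚ) (n₀ : ℕ), ∀ n ≥ n₀, g n = p.eval (n : ℚ)}
  add_mem' := by
    rintro a b ⟨p, k, hp⟩ ⟨q, l, hq⟩
    refine ⟨p + q, max k l, fun n hn => ?_⟩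
    rw [Pi.add_apply, hp n (le_of_max_le_left hn), hq n (le_of_max_le_right hn),
      Polynomial.eval_add]
  zero_mem' := ⟨0, 0, by simp⟩
  smul_mem' := by
    rintro c a ⟨p, k, hp⟩
    refine ⟨c • p, k, fun n hn => ?_⟩
    rw [Pi.smul_apply, hp n hn, Polynomial.eval_smul]

theorem eventuallyPoly_mul {f g : ℕ → ℚ} (hf : f ∈ eventuallyPoly) (hg : g ∈ eventuallyPoly) :
    f * g ∈ eventuallyPoly := by
  obtain ⟨p, k, hp⟩ := hf
  obtain ⟨q, l, hq⟩ := hg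
  refine ⟨p * q, max k l, fun n hn => ?_⟩
  rw [Pi.mul_apply, hp n (le_of_max_le_left hn), hq n (le_of_max_le_right hn),
      Polynomial.eval_mul]

theorem eventuallyPoly_of_eq {f g : ℕ → ℚ} (hf : f ∈ eventuallyPoly) (k : ℕ)
    (h : ∀ n ≥ k, g n = f n) : g ∈ eventuallyPoly := by
  obtain ⟨p, l, hp⟩ := hf
  exact ⟨p, max k l, fun n hn => by
    rw [h n (le_of_max_le_left hn), hp n (le_of_max_le_right hn)]⟩

theorem eventuallyPoly_add_nat {f : ℕ → ℚ} (hf : f ∈ eventuallyPoly) (k : ℕ) :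
    (fun n => f (n + k)) ∈ eventuallyPoly := by
  obtain ⟨p, l, hp⟩ := hf
  refine ⟨p.comp (Polynomial.X + Polynomial.C (k : ℚ)), l, fun n hn => ?_⟩
  simp [hp (n + k) (by omega)]

theorem eventuallyPoly_of_add_nat {f : ℕ → ℚ} (k : ℕ)
    (hf : (fun n => f (n + k)) ∈ eventuallyPoly) : f ∈ eventuallyPoly := by
  obtain ⟨p, l, hp⟩ := hf
  refine ⟨p.comp (Polynomial.X - Polynomial.C (k : ℚ)), l + k, fun n hn => ?_⟩
  have := hp (n - k) (by omega)
  simp only [Nat.sub_add_cancel (show k ≤ n by omega)] at this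
  rw [this]
  simp [Nat.cast_sub (show k ≤ n by omega)]

theorem eventuallyPoly_const (c : ℚ) : (fun _ => c) ∈ eventuallyPoly :=
  ⟨Polynomial.C c, 0, by simp⟩

theorem eventuallyPoly_single (a : ℕ) : (Pi.single a 1 : ℕ → ℚ) ∈ eventuallyPoly :=
  ⟨0, a + 1, fun n hn => by simp [show n ≠ a by omega]⟩

theorem exists_polynomial_sum (p : Polynomial ℚ) :
    ∃ q : Polynomial ℚ, ∀ n : ℕ, ∑ i ∈ Finset.range n, p.eval (i : ℚ) = q.eval (n : ℚ) := by
  induction p using Polynomial.induction_on' with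
  | add p q hp hq =>
    obtain ⟨p', hp'⟩ := hp
    obtain ⟨q', hq'⟩ := hq
    exact ⟨p' + q', fun n => by simp [Finset.sum_add_distrib, hp', hq']⟩
  | monomial k a =>
    refine ⟨Polynomial.C a * ∑ i ∈ Finset.range (k + 1), Polynomial.C
      (bernoulli i * ((k + 1).choose i : ℚ) / (k + 1)) * Polynomial.X ^ (k + 1 - i), fun n => ?_⟩
    simp only [Polynomial.eval_monomial, ← Finset.mul_sum, sum_range_pow, Polynomial.eval_mul,
      Polynomial.eval_C, Polynomial.eval_finsetSum, Polynomial.eval_pow, Polynomial.eval_X]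
    congr 1
    refine Finset.sum_congr rfl fun i _ => ?_
    ring

theorem eventuallyPoly_sum {f : ℕ → ℚ} (hf : f ∈ eventuallyPoly) :
    (fun n => ∑ i ∈ Finset.range n, f i) ∈ eventuallyPoly := by
  obtain ⟨p, k, hp⟩ := hf
  obtain ⟨q, hq⟩ := exists_polynomial_sum p
  refine ⟨q + Polynomial.C (∑ i ∈ Finset.range k, (f i - p.eval (i : ℚ))), k, fun n hn => ?_⟩
  rw [Polynomial.eval_add, ← hq, Polynomial.eval_C, ← sub_eq_iff_eq_add',
    ← Finset.sum_sub_distrib]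
  symm
  refine Finset.sum_subset (Finset.range_mono hn) fun i _ hi => ?_
  rw [hp i (by simpa using hi), sub_self]

/-- The span of products of two eventually polynomial sequences in independent variables. -/
def biPoly : Submodule ℚ (ℕ × ℕ → ℚ) :=
  Submodule.span ℚ {h | ∃ f ∈ eventuallyPoly, ∃ g ∈ eventuallyPoly, h = fun a => f a.1 * g a.2}

theorem biPoly_map (F : (ℕ × ℕ → ℚ) →ₗ[ℚ] (ℕ × ℕ → ℚ))
    (hF : ∀ f ∈ eventuallyPoly, ∀ g ∈ eventuallyPoly, F (fun a => f a.1 * g a.2) ∈ biPoly)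
    {h : ℕ × ℕ → ℚ} (hh : h ∈ biPoly) : F h ∈ biPoly := by
  have : biPoly ≤ biPoly.comap F := by
    refine Submodule.span_le.2 ?_
    rintro _ ⟨f, hf, g, hg, rfl⟩
    exact hF f hf g hg
  exact this hh

theorem biPoly_map_seq (F : (ℕ × ℕ → ℚ) →ₗ[ℚ] (ℕ → ℚ))
    (hF : ∀ f ∈ eventuallyPoly, ∀ g ∈ eventuallyPoly,
      F (fun a => f a.1 * g a.2) ∈ eventuallyPoly)
    {h : ℕ × ℕ → ℚ} (hh : h ∈ biPoly) : F h ∈ eventuallyPoly := by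
  have : biPoly ≤ eventuallyPoly.comap F := by
    refine Submodule.span_le.2 ?_
    rintro _ ⟨f, hf, g, hg, rfl⟩
    exact hF f hf g hg
  exact this hh

theorem biPoly_swap {h : ℕ × ℕ → ℚ} (hh : h ∈ biPoly) : (fun a => h a.swap) ∈ biPoly :=
  biPoly_map (LinearMap.funLeft ℚ ℚ Prod.swap) (fun f hf g hg =>
    Submodule.subset_span ⟨g, hg, f, hf, by funext a; simp [mul_comm]⟩) hh

theorem biPoly_diag {h : ℕ × ℕ → ℚ} (hh : h ∈ biPoly) : (fun n => h (n, n)) ∈ eventuallyPoly :=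
  biPoly_map_seq (LinearMap.funLeft ℚ ℚ fun n => (n, n)) (fun _ hf _ hg =>
    eventuallyPoly_mul hf hg) hh

theorem biPoly_row {h : ℕ × ℕ → ℚ} (hh : h ∈ biPoly) (c : ℕ) :
    (fun m => h (m, c)) ∈ eventuallyPoly :=
  biPoly_map_seq (LinearMap.funLeft ℚ ℚ fun m => (m, c)) (fun _ hf g _ =>
    eventuallyPoly_mul hf (eventuallyPoly_const (g c))) hh

theorem biPoly_sum {h : ℕ × ℕ → ℚ} (hh : h ∈ biPoly) :
    (fun n => ∑ l ∈ Finset.range n, h (n, l)) ∈ eventuallyPoly := by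
  refine biPoly_map_seq
    { toFun := fun h n => ∑ l ∈ Finset.range n, h (n, l)
      map_add' := fun a b => by funext n; simp [Finset.sum_add_distrib]
      map_smul' := fun a b => by funext n; simp [Finset.mul_sum] } (fun f hf g hg => ?_) hh
  have := eventuallyPoly_mul hf (eventuallyPoly_sum hg)
  convert this using 1
  funext n
  simp [Finset.mul_sum]

theorem biPoly_of_diff {h k : ℕ × ℕ → ℚ} (hk : k ∈ biPoly) (h0 : ∀ n, h (0, n) = k (0, n))
    (h1 : ∀ m n, h (m + 1, n) - h (m, n) = k (m + 1, n)) : h ∈ biPoly := by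
  have : h = fun a => ∑ i ∈ Finset.range (a.1 + 1), k (i, a.2) := by
    funext ⟨m, n⟩
    induction m with
    | zero => simp [h0]
    | succ m ih =>
      simp only at ih ⊢
      rw [Finset.sum_range_succ, ← ih, ← h1]
      ring
  rw [this]
  refine biPoly_map
    { toFun := fun h a => ∑ l ∈ Finset.range (a.1 + 1), h (l, a.2)
      map_add' := fun a b => by funext n; simp [Finset.sum_add_distrib]
      map_smul' := fun a b => by funext n; simp [Finset.mul_sum] } (fun f hf g hg => ?_) hk
  exact Submodule.subset_span ⟨_, eventuallyPoly_add_nat (eventuallyPoly_sum hf) 1, g, hg, by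
    funext n; simp [Finset.sum_mul]⟩

theorem biPoly_shift {h k : ℕ × ℕ → ℚ} (hk : k ∈ biPoly) (h0 : ∀ n, h (0, n) = 0)
    (h1 : ∀ m n, h (m + 1, n) = k (m, n)) : h ∈ biPoly := by
  let S : (ℕ → ℚ) → ℕ → ℚ := fun f m => if m = 0 then 0 else f (m - 1)
  have : h = fun a => if a.1 = 0 then 0 else k (a.1 - 1, a.2) := by
    funext ⟨m, n⟩
    cases m with
    | zero => simp [h0]
    | succ m => simp [h1]
  rw [this]
  refine biPoly_map
    { toFun := fun h a => if a.1 = 0 then 0 else h (a.1 - 1, a.2)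
      map_add' := fun a b => by
        funext n; by_cases hn : n.1 = 0 <;> simp [hn]
      map_smul' := fun a b => by
        funext n; by_cases hn : n.1 = 0 <;> simp [hn] } (fun f hf g hg => ?_) hk
  refine Submodule.subset_span ⟨S f, ?_, g, hg, by
    funext n; by_cases hn : n.1 = 0 <;> simp [hn, S]⟩
  refine eventuallyPoly_of_add_nat 1 ?_
  simpa [S] using hf

theorem biPoly_of_finite {h : ℕ × ℕ → ℚ} (F : Finset (ℕ × ℕ)) (hF : ∀ a ∉ F, h a = 0) :
    h ∈ biPoly := by
  have : h = ∑ b ∈ F, h b • fun a : ℕ × ℕ =>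
      (Pi.single b.1 1 : ℕ → ℚ) a.1 * (Pi.single b.2 1 : ℕ → ℚ) a.2 := by
    funext a
    rw [Finset.sum_apply]
    by_cases ha : a ∈ F
    · rw [Finset.sum_eq_single a]
      · simp
      · intro b _ hb
        have : a.1 ≠ b.1 ∨ a.2 ≠ b.2 := by
          by_contra hcon
          push Not at hcon
          exact hb (Prod.ext hcon.1.symm hcon.2.symm)
        rcases this with h | h <;> simp [Pi.single_apply, h]
      · exact fun h => absurd ha h
    · rw [hF a ha, Finset.sum_eq_zero]
      intro b hb
      have : a.1 ≠ b.1 ∨ a.2 ≠ b.2 := by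
        by_contra hcon
        push Not at hcon
        exact ha (Prod.ext hcon.1 hcon.2 ▸ hb)
      rcases this with h | h <;> simp [Pi.single_apply, h]
  rw [this]
  exact Submodule.sum_mem _ fun b _ => Submodule.smul_mem _ _
    (Submodule.subset_span ⟨_, eventuallyPoly_single b.1, _, eventuallyPoly_single b.2, rfl⟩)

end EventuallyPolynomial

section RelativeLength

variable {R : Type} [CommRing R] {X Y Z : Type} [AddCommGroup X] [Module R X]
  [AddCommGroup Y] [Module R Y] [AddCommGroup Z] [Module R Z]

theorem length_map_eq_of_inf_ker (f : X →ₗ[R] Y) (g : X →ₗ[R] Z) (B : Submodule R X)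
    (h : B ⊓ LinearMap.ker f = B ⊓ LinearMap.ker g) :
    Module.length R (B.map f) = Module.length R (B.map g) := by
  have hk : LinearMap.ker (f.domRestrict B) = LinearMap.ker (g.domRestrict B) := by
    ext ⟨x, hx⟩
    have := SetLike.ext_iff.1 h x
    simpa [hx] using this
  have e1 := (f.domRestrict B).quotKerEquivRange
  have e2 := (g.domRestrict B).quotKerEquivRange
  rw [LinearMap.range_domRestrict] at e1 e2
  rw [← e1.length_eq, ← e2.length_eq, hk]

theorem length_eq_inf_ker_add_map (f : X →ₗ[R] Y) (B : Submodule R X) :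
    Module.length R B = Module.length R ↥(B ⊓ LinearMap.ker f) + Module.length R (B.map f) := by
  have e := (f.domRestrict B).quotKerEquivRange
  rw [LinearMap.range_domRestrict] at e
  rw [← e.length_eq, Module.length_eq_add_of_exact
    (LinearMap.ker (f.domRestrict B)).subtype (LinearMap.ker (f.domRestrict B)).mkQ
    (Submodule.subtype_injective _) (Submodule.mkQ_surjective _)
    (LinearMap.exact_subtype_mkQ _)]
  congr 1
  have : (LinearMap.ker (f.domRestrict B)).map B.subtype = B ⊓ LinearMap.ker f := by
    ext x
    simp [and_comm]
  rw [← this]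
  exact (Submodule.equivMapOfInjective _ B.subtype_injective _).length_eq

/-- The length of `B / A`, for `A ≤ B`. -/
noncomputable def relLen (A B : Submodule R X) : ℕ∞ := Module.length R (B.map A.mkQ)

theorem relLen_self (A : Submodule R X) : relLen A A = 0 := by
  rw [relLen, Module.length_eq_zero_iff, Submodule.subsingleton_iff_eq_bot, eq_bot_iff]
  rintro _ ⟨x, hx, rfl⟩
  simpa using hx

theorem relLen_top (A : Submodule R X) : relLen A ⊤ = Module.length R (X ⧸ A) := by
  rw [relLen, Submodule.map_top, Submodule.range_mkQ, Module.length_top]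

theorem relLen_bot (B : Submodule R X) : relLen ⊥ B = Module.length R B := by
  rw [relLen, length_map_eq_of_inf_ker _ LinearMap.id B (by simp), Submodule.map_id]

theorem relLen_add {A B C : Submodule R X} (hAB : A ≤ B) (hBC : B ≤ C) :
    relLen A C = relLen A B + relLen B C := by
  unfold relLen
  have hA : A ≤ LinearMap.ker B.mkQ := by simpa using hAB
  have hker : LinearMap.ker (A.liftQ B.mkQ hA) = B.map A.mkQ := by
    rw [Submodule.ker_liftQ]
    exact congrArg _ (Submodule.ker_mkQ B)
  rw [length_eq_inf_ker_add_map (A.liftQ B.mkQ hA) (C.map A.mkQ), hker,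
    inf_eq_right.2 (Submodule.map_mono hBC), ← Submodule.map_comp, Submodule.liftQ_mkQ]

theorem relLen_comap (f : X →ₗ[R] Y) (B : Submodule R X) (A : Submodule R Y) :
    relLen (B ⊓ A.comap f) B = relLen A (A ⊔ B.map f) := by
  unfold relLen
  have : A.map A.mkQ = ⊥ := by simp
  rw [Submodule.map_sup, this, bot_sup_eq, ← Submodule.map_comp]
  apply length_map_eq_of_inf_ker
  rw [Submodule.ker_mkQ, LinearMap.ker_comp, Submodule.ker_mkQ, ← inf_assoc, inf_idem]

theorem relLen_mono {A B C D : Submodule R X} (hAB : A ≤ B) (hBC : B ≤ C) (hCD : C ≤ D) :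
    relLen B C ≤ relLen A D := by
  rw [relLen_add hAB (hBC.trans hCD), relLen_add hBC hCD]
  exact le_add_left le_self_add

end RelativeLength

section Hilbert

variable {R : Type} [CommRing R] {ι κ : Type}
  {X : ℕ × ℕ → Type} [∀ g, AddCommGroup (X g)] [∀ g, Module R (X g)]

/-- The image of a family of submodules under one operator. -/
def opImage (op : ∀ (s : ι ⊕ κ) (g : ℕ × ℕ), X g →ₗ[R] X (sh2 ι κ s g))
    (Z : ∀ g, Submodule R (X g)) : ∀ (_ : ι ⊕ κ) (g : ℕ × ℕ), Submodule R (X g)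
  | .inl i, (m + 1, n) => (Z (m, n)).map (op (.inl i) (m, n))
  | .inr j, (m, n + 1) => (Z (m, n)).map (op (.inr j) (m, n))
  | .inl _, (0, _) => ⊥
  | .inr _, (_, 0) => ⊥

variable {op : ∀ (s : ι ⊕ κ) (g : ℕ × ℕ), X g →ₗ[R] X (sh2 ι κ s g)}

theorem op_mem_opImage {Z : ∀ g, Submodule R (X g)} {s : ι ⊕ κ} {g : ℕ × ℕ} {y : X g}
    (hy : y ∈ Z g) : op s g y ∈ opImage op Z s (sh2 ι κ s g) := by
  rcases s with i | j <;> exact ⟨y, hy, rfl⟩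

theorem opImage_induction {Z : ∀ g, Submodule R (X g)} {s : ι ⊕ κ}
    {p : ∀ g, X g → Prop} (h0 : ∀ g, p g 0)
    (h : ∀ g, ∀ y ∈ Z g, p (sh2 ι κ s g) (op s g y)) {g : ℕ × ℕ} {x : X g}
    (hx : x ∈ opImage op Z s g) : p g x := by
  obtain ⟨m, n⟩ := g
  rcases s with i | j
  · rcases m with _ | m
    · obtain rfl : x = 0 := by simpa [opImage] using hx
      exact h0 _
    · obtain ⟨y, hy, rfl⟩ := hx
      exact h (m, n) y hy
  · rcases n with _ | n
    · obtain rfl : x = 0 := by simpa [opImage] using hx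
      exact h0 _
    · obtain ⟨y, hy, rfl⟩ := hx
      exact h (m, n) y hy

theorem OpComm.mem_iff (hc : OpComm op) {Z : ∀ g, Submodule R (X g)} {s t : ι ⊕ κ} {g : ℕ × ℕ}
    {x : X g} : op s _ (op t g x) ∈ Z _ ↔ op t _ (op s g x) ∈ Z _ := by
  rw [← lof_mem_totalSub, hc, lof_mem_totalSub]

theorem stable_opImage (hc : OpComm op) {Z : ∀ g, Submodule R (X g)} (hZ : Stable op Z)
    (s : ι ⊕ κ) : Stable op (opImage op Z s) := by
  intro t g x hx
  refine opImage_induction (op := op) (p := fun g x => op t g x ∈ opImage op Z s _) ?_ ?_ hx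
  · intro g
    simp
  · intro g y hy
    rw [hc.mem_iff]
    exact op_mem_opImage (hZ t g y hy)

/-- Ascending chain condition on the families between two given ones that are stable under the
operators in `S`. -/
def NoeBetween (op : ∀ (s : ι ⊕ κ) (g : ℕ × ℕ), X g →ₗ[R] X (sh2 ι κ s g)) (S : Set (ι ⊕ κ))
    (A B : ∀ g, Submodule R (X g)) : Prop :=
  WellFoundedGT {Z : ∀ g, Submodule R (X g) // StableOn op S Z ∧ A ≤ Z ∧ Z ≤ B}

theorem NoeBetween.mono {S S' : Set (ι ⊕ κ)} {A B A' B' : ∀ g, Submodule R (X g)}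
    (h : NoeBetween op S A B) (hA : A ≤ A') (hB : B' ≤ B)
    (hS : ∀ Z : ∀ g, Submodule R (X g), A' ≤ Z → Z ≤ B' → StableOn op S' Z → StableOn op S Z) :
    NoeBetween op S' A' B' := by
  unfold NoeBetween at *
  let F : {Z : ∀ g, Submodule R (X g) // StableOn op S' Z ∧ A' ≤ Z ∧ Z ≤ B'} →
      {Z : ∀ g, Submodule R (X g) // StableOn op S Z ∧ A ≤ Z ∧ Z ≤ B} := fun Z =>
    ⟨Z.1, hS Z.1 Z.2.2.1 Z.2.2.2 Z.2.1, hA.trans Z.2.2.1, Z.2.2.2.trans hB⟩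
  have hF : StrictMono F := fun Z Z' h => h
  exact hF.wellFoundedGT

theorem Noe.noeBetween (h : Noe op) (A B : ∀ g, Submodule R (X g)) :
    NoeBetween op Set.univ A B := by
  unfold Noe at h
  unfold NoeBetween
  let F : {Z : ∀ g, Submodule R (X g) // StableOn op Set.univ Z ∧ A ≤ Z ∧ Z ≤ B} →
      {Z : ∀ g, Submodule R (X g) // Stable op Z} := fun Z =>
    ⟨Z.1, fun s g z hz => Z.2.1 s trivial g z hz⟩
  have hF : StrictMono F := fun Z Z' h => h
  exact hF.wellFoundedGT

theorem NoeBetween.finite {A B : ∀ g, Submodule R (X g)} (h : NoeBetween op ∅ A B)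
    (hAB : A ≤ B) : ∃ F : Finset (ℕ × ℕ), ∀ g ∉ F, A g = B g := by
  classical
  unfold NoeBetween at h
  let T : Finset (ℕ × ℕ) →
      {Z : ∀ g, Submodule R (X g) // StableOn op ∅ Z ∧ A ≤ Z ∧ Z ≤ B} := fun F =>
    ⟨fun g => if g ∈ F then B g else A g, fun s hs => hs.elim,
      fun g => by by_cases hg : g ∈ F <;> simp [hg, hAB g],
      fun g => by by_cases hg : g ∈ F <;> simp [hg, hAB g]⟩
  obtain ⟨F, -, hM⟩ := (InvImage.wf T h.wf).has_min Set.univ ⟨∅, trivial⟩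
  refine ⟨F, fun g hg => ?_⟩
  by_contra hne
  refine hM (insert g F) trivial ?_
  change T F < T (insert g F)
  refine lt_of_le_of_ne ?_ ?_
  · intro g'
    change (if g' ∈ F then B g' else A g') ≤ (if g' ∈ insert g F then B g' else A g')
    split_ifs with h1 h2 h2
    · exact le_rfl
    · exact absurd (Finset.mem_insert_of_mem h1) h2
    · exact hAB g'
    · exact le_rfl
  · intro heq
    have := congrFun (congrArg Subtype.val heq) g
    simp [T, hg] at this
    exact hne this

theorem relLen_toNat_mem_biPoly_aux [Finite ι] [Finite κ] (hc : OpComm op)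
    (S : Finset (ι ⊕ κ)) : ∀ A B : ∀ g, Submodule R (X g), Stable op A → Stable op B → A ≤ B →
    (∀ g, relLen (A g) (B g) ≠ ⊤) → NoeBetween op S A B →
    (fun g => ((relLen (A g) (B g)).toNat : ℚ)) ∈ biPoly := by
  classical
  induction S using Finset.induction_on with
  | empty =>
    intro A B _ _ hAB _ hN
    rw [Finset.coe_empty] at hN
    obtain ⟨F, hF⟩ := hN.finite hAB
    refine biPoly_of_finite F fun a ha => ?_
    rw [hF a ha, relLen_self]
    rfl
  | insert s S _ ih =>
    intro A B hA hB hAB hfin hN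
    let K : ∀ g, Submodule R (X g) := fun g => B g ⊓ (A (sh2 ι κ s g)).comap (op s g)
    let C : ∀ g, Submodule R (X g) := fun g => A g ⊔ opImage op B s g
    have hAK : A ≤ K := fun g => le_inf (hAB g) fun x hx => hA s g x hx
    have hKB : K ≤ B := fun g => inf_le_left
    have hAC : A ≤ C := fun g => le_sup_left
    have hCB : C ≤ B := fun g => sup_le (hAB g) fun x hx =>
      opImage_induction (op := op) (p := fun g x => x ∈ B g) (fun _ => zero_mem _)
        (fun g y hy => hB s g y hy) hx
    have hK : Stable op K := by
      intro t g x hx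
      refine ⟨hB t g x hx.1, ?_⟩
      change op s _ (op t g x) ∈ A _
      rw [hc.mem_iff]
      exact hA t _ _ hx.2
    have hC : Stable op C := by
      intro t g x hx
      obtain ⟨a, ha, b, hb, rfl⟩ := Submodule.mem_sup.1 hx
      rw [map_add]
      exact Submodule.add_mem_sup (hA t g a ha) (stable_opImage hc hB s t g b hb)
    have hfK : ∀ g, relLen (A g) (K g) ≠ ⊤ := fun g =>
      ne_top_of_le_ne_top (hfin g) (relLen_mono le_rfl (hAK g) (hKB g))
    have hfC : ∀ g, relLen (C g) (B g) ≠ ⊤ := fun g =>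
      ne_top_of_le_ne_top (hfin g) (relLen_mono (hAC g) (hCB g) le_rfl)
    have hfK' : ∀ g, relLen (K g) (B g) ≠ ⊤ := fun g =>
      ne_top_of_le_ne_top (hfin g) (relLen_mono (hAK g) (hKB g) le_rfl)
    have ihK := ih A K hA hK hAK hfK (hN.mono le_rfl hKB fun Z h1 h2 h3 t ht g z hz => by
      rcases Finset.mem_insert.1 (Finset.mem_coe.1 ht) with rfl | h
      · exact h1 _ (h2 g hz).2
      · exact h3 t h g z hz)
    have ihC := ih C B hC hB hCB hfC (hN.mono hAC le_rfl fun Z h1 h2 h3 t ht g z hz => by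
      rcases Finset.mem_insert.1 (Finset.mem_coe.1 ht) with rfl | h
      · exact h1 _ (Submodule.mem_sup_right (op_mem_opImage (h2 g hz)))
      · exact h3 t h g z hz)
    have hrel : ∀ g, ((relLen (A (sh2 ι κ s g)) (B (sh2 ι κ s g))).toNat : ℚ) -
        (relLen (A g) (B g)).toNat = (relLen (C (sh2 ι κ s g)) (B (sh2 ι κ s g))).toNat -
          (relLen (A g) (K g)).toNat := by
      intro g
      have h1 := relLen_add (hAK g) (hKB g)
      have h2 := relLen_add (hAC (sh2 ι κ s g)) (hCB (sh2 ι κ s g))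
      have h3 : relLen (K g) (B g) = relLen (A (sh2 ι κ s g)) (C (sh2 ι κ s g)) := by
        have : opImage op B s (sh2 ι κ s g) = (B g).map (op s g) := by
          rcases s with i | j <;> rfl
        change relLen (B g ⊓ _) _ = relLen _ (A _ ⊔ _)
        rw [relLen_comap, this]
      rw [h1, h2, ENat.toNat_add (hfK g) (hfK' g), ENat.toNat_add (h3 ▸ hfK' g) (hfC _), h3]
      push_cast
      ring
    rcases s with i | j
    · refine biPoly_of_diff (k := fun g => ((relLen (C g) (B g)).toNat : ℚ) -
        (if g.1 = 0 then 0 else ((relLen (A (g.1 - 1, g.2)) (K (g.1 - 1, g.2))).toNat : ℚ)))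
        (Submodule.sub_mem _ ihC (biPoly_shift ihK (by simp) (by simp))) (fun n => ?_)
        (fun m n => ?_)
      · have : C (0, n) = A (0, n) := sup_bot_eq _
        simp [this]
      · simpa using hrel (m, n)
    · have ihC' := biPoly_swap ihC
      have ihK' := biPoly_swap ihK
      refine biPoly_swap (h := fun g => ((relLen (A g.swap) (B g.swap)).toNat : ℚ)) ?_
      refine biPoly_of_diff (k := fun g => ((relLen (C g.swap) (B g.swap)).toNat : ℚ) -
        (if g.1 = 0 then 0 else ((relLen (A (g.2, g.1 - 1)) (K (g.2, g.1 - 1))).toNat : ℚ)))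
        (Submodule.sub_mem _ ihC' (biPoly_shift ihK' (by simp) (by simp))) (fun n => ?_)
        (fun m n => ?_)
      · have : C (n, 0) = A (n, 0) := sup_bot_eq _
        simp [this]
      · simpa using hrel (n, m)

/-- In a Noetherian bigraded family, relative lengths of stable families of submodules are
sums of products of eventually polynomial sequences. -/
theorem Noe.relLen_mem_biPoly [Finite ι] [Finite κ] (h : Noe op) (hc : OpComm op)
    {A B : ∀ g, Submodule R (X g)} (hA : Stable op A) (hB : Stable op B) (hAB : A ≤ B)
    (hfin : ∀ g, relLen (A g) (B g) ≠ ⊤) :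
    (fun g => ((relLen (A g) (B g)).toNat : ℚ)) ∈ biPoly := by
  classical
  have : Fintype (ι ⊕ κ) := Fintype.ofFinite _
  refine relLen_toNat_mem_biPoly_aux hc Finset.univ A B hA hB hAB hfin ?_
  rw [Finset.coe_univ]
  exact h.noeBetween A B

end Hilbert

section Resolution

variable (R : Type) [CommRing R]

/-- The functorial free module on the underlying set of a module. -/
noncomputable def freeOn : ModuleCat.{0} R ⥤ ModuleCat.{0} R where
  obj Y := ModuleCat.of R (Y →₀ R)
  map f := ModuleCat.ofHom (Finsupp.lmapDomain R R f.hom)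
  map_id Y := by ext1; exact Finsupp.lmapDomain_id R R
  map_comp f g := by ext1; exact Finsupp.lmapDomain_comp R R f.hom g.hom

variable {R} in
/-- The canonical surjection from the free module on a module. -/
noncomputable def freeCounit (Y : Type) [AddCommGroup Y] [Module R Y] : (Y →₀ R) →ₗ[R] Y :=
  Finsupp.linearCombination R id

variable {R} in
theorem freeCounit_naturality {Y Y' : Type} [AddCommGroup Y] [Module R Y] [AddCommGroup Y']
    [Module R Y'] (f : Y →ₗ[R] Y') (x : Y →₀ R) :
    freeCounit Y' (Finsupp.lmapDomain R R f x) = f (freeCounit Y x) := by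
  simp [freeCounit, Finsupp.lmapDomain_apply, Finsupp.linearCombination_mapDomain,
    Finsupp.apply_linearCombination]

/-- The functorial first syzygy module. -/
noncomputable def syzOn : ModuleCat.{0} R ⥤ ModuleCat.{0} R where
  obj Y := ModuleCat.of R (LinearMap.ker (freeCounit (R := R) Y))
  map {Y Y'} f := ModuleCat.ofHom ((Finsupp.lmapDomain R R f.hom).restrict fun x hx => by
    rw [LinearMap.mem_ker] at hx ⊢
    rw [freeCounit_naturality, hx, map_zero])
  map_id Y := by
    ext ⟨x, hx⟩ : 3
    exact congrFun (congrArg DFunLike.coe (Finsupp.lmapDomain_id R R)) x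
  map_comp f g := by
    ext ⟨x, hx⟩ : 3
    exact congrFun (congrArg DFunLike.coe (Finsupp.lmapDomain_comp R R f.hom g.hom)) x

/-- Iterated syzygies, shifted so that the module itself sits in degree one. -/
noncomputable def syzFun : ℕ → (ModuleCat.{0} R ⥤ ModuleCat.{0} R)
  | 0 => (Functor.const _).obj (ModuleCat.of R PUnit)
  | 1 => 𝟭 _
  | k + 2 => syzFun (k + 1) ⋙ syzOn R

/-- The terms of the functorial free resolution, shifted by two. -/
noncomputable def resFun : ℕ → (ModuleCat.{0} R ⥤ ModuleCat.{0} R)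
  | 0 => (Functor.const _).obj (ModuleCat.of R PUnit)
  | 1 => (Functor.const _).obj (ModuleCat.of R PUnit)
  | k + 2 => syzFun R (k + 1) ⋙ freeOn R

variable (k : ℕ) (Y : Type) [AddCommGroup Y] [Module R Y]

/-- The underlying module of the iterated syzygy. -/
abbrev Syz : Type := (syzFun R k).obj (ModuleCat.of R Y)

/-- The underlying module of a term of the resolution. -/
abbrev Res : Type := (resFun R k).obj (ModuleCat.of R Y)

/-- The inclusion of a syzygy. -/
noncomputable def syzIncl : ∀ k : ℕ, Syz R k Y →ₗ[R] Res R k Y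
  | 0 => 0
  | 1 => 0
  | k + 2 => (LinearMap.ker (freeCounit (R := R) (Syz R (k + 1) Y))).subtype

/-- The surjection onto a syzygy. -/
noncomputable def resProj : ∀ k : ℕ, Res R (k + 1) Y →ₗ[R] Syz R k Y
  | 0 => 0
  | k + 1 => freeCounit (R := R) (Syz R (k + 1) Y)

theorem resProj_surjective : ∀ k : ℕ, Function.Surjective (resProj R Y k)
  | 0 => fun _ => ⟨0, Subsingleton.elim (α := PUnit) _ _⟩
  | _ + 1 => fun x => ⟨Finsupp.single x 1,
      (Finsupp.linearCombination_single R 1 x).trans (one_smul R x)⟩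

theorem exact_syzIncl_resProj : ∀ k : ℕ,
    Function.Exact (syzIncl R Y (k + 1)) (resProj R Y k)
  | 0 => fun _ => ⟨fun _ => ⟨0, Subsingleton.elim (α := PUnit) _ _⟩, fun _ => rfl⟩
  | _ + 1 => LinearMap.exact_subtype_ker_map _

theorem syzIncl_injective (k : ℕ) : Function.Injective (syzIncl R Y (k + 2)) :=
  Submodule.subtype_injective _

theorem flat_res : ∀ k : ℕ, Module.Flat R (Res R k Y)
  | 0 => inferInstanceAs (Module.Flat R PUnit)
  | 1 => inferInstanceAs (Module.Flat R PUnit)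
  | k + 2 => inferInstanceAs (Module.Flat R (Syz R (k + 1) Y →₀ R))

variable {Y} {Y' Y'' : Type} [AddCommGroup Y'] [Module R Y'] [AddCommGroup Y''] [Module R Y'']

/-- Functoriality of syzygies. -/
noncomputable def syzMap (f : Y →ₗ[R] Y') : Syz R k Y →ₗ[R] Syz R k Y' :=
  ((syzFun R k).map (ModuleCat.ofHom f)).hom

/-- Functoriality of the resolution. -/
noncomputable def resMap (f : Y →ₗ[R] Y') : Res R k Y →ₗ[R] Res R k Y' :=
  ((resFun R k).map (ModuleCat.ofHom f)).hom

theorem syzMap_id : syzMap R k (LinearMap.id : Y →ₗ[R] Y) = LinearMap.id := by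
  simp [syzMap]

theorem syzMap_comp (g : Y' →ₗ[R] Y'') (f : Y →ₗ[R] Y') :
    syzMap R k (g ∘ₗ f) = syzMap R k g ∘ₗ syzMap R k f := by
  simp [syzMap]

theorem syzIncl_naturality (f : Y →ₗ[R] Y') : ∀ k : ℕ,
    syzIncl R Y' k ∘ₗ syzMap R k f = resMap R k f ∘ₗ syzIncl R Y k
  | 0 => rfl
  | 1 => by ext x; exact Subsingleton.elim (α := PUnit) _ _
  | k + 2 => rfl

theorem resProj_naturality (f : Y →ₗ[R] Y') : ∀ k : ℕ,
    resProj R Y' k ∘ₗ resMap R (k + 1) f = syzMap R k f ∘ₗ resProj R Y k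
  | 0 => by ext x; exact Subsingleton.elim (α := PUnit) _ _
  | k + 1 => by ext1 x; exact freeCounit_naturality _ _

end Resolution

section TorModule
open TensorProduct

variable {R : Type} [CommRing R]
  {X X' X'' W W' W'' : Type} [AddCommGroup X] [Module R X] [AddCommGroup X'] [Module R X']
  [AddCommGroup X''] [Module R X''] [AddCommGroup W] [Module R W] [AddCommGroup W'] [Module R W']
  [AddCommGroup W''] [Module R W'']
  {Y Y' Y'' : Type} [AddCommGroup Y] [Module R Y] [AddCommGroup Y'] [Module R Y']
  [AddCommGroup Y''] [Module R Y'']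

variable (R) in
/-- A concrete model of `Tor`, shifted by one: `torM R (k + 1) X Y` is `Tor_k(X, Y)`. -/
noncomputable def torM (k : ℕ) (X Y : Type) [AddCommGroup X] [Module R X]
    [AddCommGroup Y] [Module R Y] : Submodule R (X ⊗[R] Syz R k Y) :=
  LinearMap.ker ((syzIncl R Y k).lTensor X)

theorem map_syzMap_mem_torM (k : ℕ) (f : X →ₗ[R] X') (g : Y →ₗ[R] Y') {z : X ⊗[R] Syz R k Y}
    (hz : z ∈ torM R k X Y) : TensorProduct.map f (syzMap R k g) z ∈ torM R k X' Y' := by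
  rw [torM, LinearMap.mem_ker] at hz ⊢
  have : (syzIncl R Y' k).lTensor X' ∘ₗ TensorProduct.map f (syzMap R k g) =
      TensorProduct.map f (resMap R k g) ∘ₗ (syzIncl R Y k).lTensor X := by
    rw [LinearMap.lTensor, LinearMap.lTensor, ← TensorProduct.map_comp, ← TensorProduct.map_comp,
      syzIncl_naturality]
    rfl
  have h := LinearMap.congr_fun this z
  simp only [LinearMap.comp_apply, hz, map_zero] at h
  exact h

/-- Functoriality of `torM` in both variables. -/
noncomputable def torMap (k : ℕ) (f : X →ₗ[R] X') (g : Y →ₗ[R] Y') :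
    torM R k X Y →ₗ[R] torM R k X' Y' :=
  (TensorProduct.map f (syzMap R k g)).restrict fun _ => map_syzMap_mem_torM k f g

theorem torMap_coe (k : ℕ) (f : X →ₗ[R] X') (g : Y →ₗ[R] Y') (z : torM R k X Y) :
    (torMap k f g z : X' ⊗[R] Syz R k Y') = TensorProduct.map f (syzMap R k g) z := rfl

theorem torMap_id (k : ℕ) (z : torM R k X Y) :
    torMap k (LinearMap.id : X →ₗ[R] X) (LinearMap.id : Y →ₗ[R] Y) z = z := by
  apply Subtype.ext
  rw [torMap_coe, syzMap_id, TensorProduct.map_id, LinearMap.id_apply]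

theorem torMap_torMap (k : ℕ) (f' : X' →ₗ[R] X'') (f : X →ₗ[R] X') (g' : Y' →ₗ[R] Y'')
    (g : Y →ₗ[R] Y') (z : torM R k X Y) :
    torMap k f' g' (torMap k f g z) = torMap k (f' ∘ₗ f) (g' ∘ₗ g) z := by
  apply Subtype.ext
  simp only [torMap_coe]
  rw [syzMap_comp, TensorProduct.map_comp, LinearMap.comp_apply]

theorem torMap_smul_left (k : ℕ) (r : R) (f : X →ₗ[R] X') (g : Y →ₗ[R] Y') (z : torM R k X Y) :
    torMap k (r • f) g z = r • torMap k f g z := by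
  apply Subtype.ext
  simp only [torMap_coe, Submodule.coe_smul]
  rw [TensorProduct.map_smul_left, LinearMap.smul_apply]

instance (X Y : Type) [AddCommGroup X] [Module R X] [AddCommGroup Y] [Module R Y] :
    Subsingleton (torM R 0 X Y) := by
  have : Subsingleton (Syz R 0 Y) := inferInstanceAs (Subsingleton PUnit)
  infer_instance

/-- `Tor_0` is the tensor product. -/
noncomputable def torMOne (X Y : Type) [AddCommGroup X] [Module R X]
    [AddCommGroup Y] [Module R Y] : torM R 1 X Y ≃ₗ[R] X ⊗[R] Y :=
  LinearEquiv.ofTop (torM R 1 X Y) (by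
    have : Subsingleton (Res R 1 Y) := inferInstanceAs (Subsingleton PUnit)
    rw [torM, LinearMap.ker_eq_top]
    exact Subsingleton.elim _ _)

theorem torMOne_naturality (f : X →ₗ[R] X') (g : Y →ₗ[R] Y') (z : torM R 1 X Y) :
    torMOne X' Y' (torMap 1 f g z) = TensorProduct.map f g (torMOne X Y z) := rfl

theorem subsingleton_torM_of_flat (k : ℕ) [Module.Flat R X] : Subsingleton (torM R (k + 2) X Y) := by
  rw [Submodule.subsingleton_iff_eq_bot, torM, LinearMap.ker_eq_bot]
  exact Module.Flat.lTensor_preserves_injective_linearMap _ (syzIncl_injective R Y k)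

variable (R) in
/-- Short exact sequences of modules. -/
structure SES (X' X X'' : Type) [AddCommGroup X] [Module R X] [AddCommGroup X'] [Module R X']
    [AddCommGroup X''] [Module R X''] where
  /-- the injection -/
  f : X' →ₗ[R] X
  /-- the surjection -/
  g : X →ₗ[R] X''
  inj : Function.Injective f
  surj : Function.Surjective g
  exact : Function.Exact f g

section ConnectingMap

variable (S : SES R X' X X'') (k : ℕ) (Y)

theorem rTensor_res_injective : Function.Injective (S.f.rTensor (Res R k Y)) :=
  have := flat_res R Y k
  Module.Flat.rTensor_preserves_injective_linearMap _ S.inj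

theorem lTensor_resProj_surjective (X : Type) [AddCommGroup X] [Module R X] :
    Function.Surjective ((resProj R Y k).lTensor X) :=
  LinearMap.lTensor_surjective X (resProj_surjective R Y k)

theorem lTensor_syz_exact (X : Type) [AddCommGroup X] [Module R X] :
    Function.Exact ((syzIncl R Y (k + 1)).lTensor X) ((resProj R Y k).lTensor X) :=
  lTensor_exact X (exact_syzIncl_resProj R Y k) (resProj_surjective R Y k)

/-- The connecting map, with values in the tensor product. -/
noncomputable def preConn : torM R (k + 1) X'' Y →ₗ[R] X' ⊗[R] Syz R k Y :=
  SnakeLemma.δ' ((syzIncl R Y (k + 1)).lTensor X') ((syzIncl R Y (k + 1)).lTensor X)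
    ((syzIncl R Y (k + 1)).lTensor X'') (S.f.rTensor _) (S.g.rTensor _)
    (rTensor_exact _ S.exact S.surj) (S.f.rTensor _) (S.g.rTensor _)
    (rTensor_exact _ S.exact S.surj) (by ext; rfl) (by ext; rfl)
    (torM R (k + 1) X'' Y).subtype (LinearMap.exact_subtype_ker_map _)
    ((resProj R Y k).lTensor X') (lTensor_syz_exact Y k X')
    (LinearMap.rTensor_surjective _ S.surj) (rTensor_res_injective Y S (k + 1))

theorem preConn_eq (z : torM R (k + 1) X'' Y) (a : X ⊗[R] Syz R (k + 1) Y)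
    (ha : S.g.rTensor _ a = z) (b : X' ⊗[R] Res R (k + 1) Y)
    (hb : S.f.rTensor _ b = (syzIncl R Y (k + 1)).lTensor X a) :
    preConn Y S k z = (resProj R Y k).lTensor X' b :=
  SnakeLemma.δ'_eq _ _ _ _ _ _ _ _ _ _ _ _ _ _ _ _ _ z a ha b hb

theorem preConn_rep (z : torM R (k + 1) X'' Y) : ∃ (a : X ⊗[R] Syz R (k + 1) Y)
    (b : X' ⊗[R] Res R (k + 1) Y), S.g.rTensor _ a = z ∧
    S.f.rTensor _ b = (syzIncl R Y (k + 1)).lTensor X a ∧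
    preConn Y S k z = (resProj R Y k).lTensor X' b := by
  obtain ⟨a, ha⟩ := LinearMap.rTensor_surjective (Syz R (k + 1) Y) S.surj (z : X'' ⊗[R] _)
  have hz : (syzIncl R Y (k + 1)).lTensor X'' z = 0 := z.2
  have : S.g.rTensor _ ((syzIncl R Y (k + 1)).lTensor X a) = 0 := by
    rw [← hz, ← ha, ← LinearMap.comp_apply, ← LinearMap.comp_apply, LinearMap.rTensor_comp_lTensor,
      LinearMap.lTensor_comp_rTensor]
  obtain ⟨b, hb⟩ := (rTensor_exact _ S.exact S.surj _).1 this
  exact ⟨a, b, ha, hb, preConn_eq Y S k z a ha b hb⟩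

theorem exact_torMap_preConn :
    Function.Exact (torMap (k + 1) S.g (LinearMap.id : Y →ₗ[R] Y)) (preConn Y S k) := by
  refine SnakeLemma.exact_δ'_right _ _ _ _ _ _ _ _ _ _ _ (torM R (k + 1) X Y).subtype
    (LinearMap.exact_subtype_ker_map _) _ _ _ _ _ _ _ ?_ (Submodule.subtype_injective _)
  ext z
  change _ = (TensorProduct.map S.g (syzMap R (k + 1) LinearMap.id)) z.1
  rw [syzMap_id]
  rfl

theorem exact_preConn_rTensor :
    Function.Exact (preConn Y S k) (S.f.rTensor (Syz R k Y)) := by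
  refine SnakeLemma.exact_δ'_left _ _ _ _ _ _ _ _ _ _ _ _ _ _ _
    ((resProj R Y k).lTensor X) (lTensor_syz_exact Y k X) _ _ _ ?_
    (lTensor_resProj_surjective Y k X')
  ext; rfl

theorem preConn_mem (z : torM R (k + 1) X'' Y) : preConn Y S k z ∈ torM R k X' Y := by
  have h := (exact_preConn_rTensor Y S k).apply_apply_eq_zero z
  rw [torM, LinearMap.mem_ker]
  apply rTensor_res_injective Y S k
  rw [map_zero, ← LinearMap.comp_apply, LinearMap.rTensor_comp_lTensor,
    ← LinearMap.lTensor_comp_rTensor, LinearMap.comp_apply, h, map_zero]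

/-- The connecting map of the long exact sequence in the first variable. -/
noncomputable def conn : torM R (k + 1) X'' Y →ₗ[R] torM R k X' Y :=
  (preConn Y S k).codRestrict _ (preConn_mem Y S k)

theorem exact_torMap_conn :
    Function.Exact (torMap (k + 1) S.g (LinearMap.id : Y →ₗ[R] Y)) (conn Y S k) := by
  intro z
  rw [← exact_torMap_preConn Y S k z, ← Subtype.coe_inj]
  rfl

theorem torMap_id_right_coe (f : X →ₗ[R] X') (z : torM R k X Y) :
    (torMap k f (LinearMap.id : Y →ₗ[R] Y) z : X' ⊗[R] Syz R k Y) = f.rTensor _ z := by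
  rw [torMap_coe, syzMap_id]
  rfl

theorem exact_conn_torMap :
    Function.Exact (conn Y S k) (torMap k S.f (LinearMap.id : Y →ₗ[R] Y)) := by
  intro z
  rw [← Subtype.coe_inj, torMap_id_right_coe, Submodule.coe_zero, exact_preConn_rTensor Y S k z.1]
  constructor
  · rintro ⟨w, hw⟩
    exact ⟨w, Subtype.ext hw⟩
  · rintro ⟨w, hw⟩
    exact ⟨w, congrArg Subtype.val hw⟩

theorem exact_torMap_torMap :
    Function.Exact (torMap (k + 1) S.f (LinearMap.id : Y →ₗ[R] Y))
      (torMap (k + 1) S.g (LinearMap.id : Y →ₗ[R] Y)) := by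
  intro z
  rw [← Subtype.coe_inj, torMap_id_right_coe, Submodule.coe_zero, rTensor_exact _ S.exact S.surj]
  constructor
  · rintro ⟨w, hw⟩
    refine ⟨⟨w, ?_⟩, Subtype.ext ((torMap_id_right_coe _ _ _ _).trans hw)⟩
    rw [torM, LinearMap.mem_ker]
    apply rTensor_res_injective Y S (k + 1)
    rw [map_zero, ← LinearMap.comp_apply, LinearMap.rTensor_comp_lTensor,
      ← LinearMap.lTensor_comp_rTensor, LinearMap.comp_apply, hw]
    exact z.2
  · rintro ⟨w, hw⟩
    exact ⟨w, by rw [← hw, torMap_id_right_coe]⟩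

end ConnectingMap

/-- Surjectivity at the end of the long exact sequence. -/
theorem torMap_one_surjective (S : SES R X' X X'') :
    Function.Surjective (torMap 1 S.g (LinearMap.id : Y →ₗ[R] Y)) := by
  intro z
  obtain ⟨w, hw⟩ := LinearMap.rTensor_surjective Y S.surj (torMOne _ _ z)
  refine ⟨(torMOne _ _).symm w, (torMOne _ _).injective ?_⟩
  rw [torMOne_naturality, LinearEquiv.apply_symm_apply, ← hw]
  rfl

theorem conn_naturality (S : SES R X' X X'') (S₂ : SES R W' W W'') (k : ℕ)
    (α' : X' →ₗ[R] W') (α : X →ₗ[R] W) (α'' : X'' →ₗ[R] W'') (η : Y →ₗ[R] Y')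
    (hf : α ∘ₗ S.f = S₂.f ∘ₗ α') (hg : α'' ∘ₗ S.g = S₂.g ∘ₗ α) (z : torM R (k + 1) X'' Y) :
    conn Y' S₂ k (torMap (k + 1) α'' η z) = torMap k α' η (conn Y S k z) := by
  apply Subtype.ext
  rw [torMap_coe]
  obtain ⟨a, b, ha, hb, hab⟩ := preConn_rep Y S k z
  change preConn Y' S₂ k _ = TensorProduct.map α' (syzMap R k η) (preConn Y S k z)
  rw [hab, preConn_eq Y' S₂ k _ (TensorProduct.map α (syzMap R (k + 1) η) a) ?_
    (TensorProduct.map α' (resMap R (k + 1) η) b) ?_]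
  · have : (resProj R Y' k).lTensor W' ∘ₗ TensorProduct.map α' (resMap R (k + 1) η) =
        TensorProduct.map α' (syzMap R k η) ∘ₗ (resProj R Y k).lTensor X' := by
      rw [LinearMap.lTensor, LinearMap.lTensor, ← TensorProduct.map_comp,
        ← TensorProduct.map_comp, resProj_naturality]
      rfl
    exact LinearMap.congr_fun this b
  · rw [torMap_coe, ← ha]
    have : S₂.g.rTensor _ ∘ₗ TensorProduct.map α (syzMap R (k + 1) η) =
        TensorProduct.map α'' (syzMap R (k + 1) η) ∘ₗ S.g.rTensor _ := by
      rw [LinearMap.rTensor, LinearMap.rTensor, ← TensorProduct.map_comp,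
        ← TensorProduct.map_comp, hg]
      rfl
    exact LinearMap.congr_fun this a
  · have h1 : S₂.f.rTensor _ ∘ₗ TensorProduct.map α' (resMap R (k + 1) η) =
        TensorProduct.map α (resMap R (k + 1) η) ∘ₗ S.f.rTensor _ := by
      rw [LinearMap.rTensor, LinearMap.rTensor, ← TensorProduct.map_comp,
        ← TensorProduct.map_comp, hf]
      rfl
    have h2 : (syzIncl R Y' (k + 1)).lTensor W ∘ₗ TensorProduct.map α (syzMap R (k + 1) η) =
        TensorProduct.map α (resMap R (k + 1) η) ∘ₗ (syzIncl R Y (k + 1)).lTensor X := by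
      rw [LinearMap.lTensor, LinearMap.lTensor, ← TensorProduct.map_comp,
        ← TensorProduct.map_comp, syzIncl_naturality]
      rfl
    refine (LinearMap.congr_fun h1 b).trans ?_
    rw [LinearMap.comp_apply, hb]
    exact (LinearMap.congr_fun h2 a).symm

end TorModule

section Snake

variable {R : Type} [CommRing R] {A₁ A₂ A₃ B₁ B₂ B₃ K₂ K₃ C₁ C₂ : Type}
  [AddCommGroup A₁] [Module R A₁] [AddCommGroup A₂] [Module R A₂] [AddCommGroup A₃] [Module R A₃]
  [AddCommGroup B₁] [Module R B₁] [AddCommGroup B₂] [Module R B₂] [AddCommGroup B₃] [Module R B₃]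
  [AddCommGroup K₂] [Module R K₂] [AddCommGroup K₃] [Module R K₃]
  [AddCommGroup C₁] [Module R C₁] [AddCommGroup C₂] [Module R C₂]

/-- The snake lemma, in existential form. -/
theorem exists_snake (i₁ : A₁ →ₗ[R] B₁) (i₂ : A₂ →ₗ[R] B₂) (i₃ : A₃ →ₗ[R] B₃)
    {f₁ : A₁ →ₗ[R] A₂} {f₂ : A₂ →ₗ[R] A₃} (hf : Function.Exact f₁ f₂)
    {g₁ : B₁ →ₗ[R] B₂} {g₂ : B₂ →ₗ[R] B₃} (hg : Function.Exact g₁ g₂)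
    (h₁ : ∀ x, i₂ (f₁ x) = g₁ (i₁ x)) (h₂ : ∀ x, i₃ (f₂ x) = g₂ (i₂ x))
    {j₂ : K₂ →ₗ[R] A₂} (hj₂ : Function.Exact j₂ i₂) {j₃ : K₃ →ₗ[R] A₃} (hj₃ : Function.Exact j₃ i₃)
    {F : K₂ →ₗ[R] K₃} (hF : ∀ x, f₂ (j₂ x) = j₃ (F x)) (hj₃' : Function.Injective j₃)
    {p₁ : B₁ →ₗ[R] C₁} (hp₁ : Function.Exact i₁ p₁) {p₂ : B₂ →ₗ[R] C₂} (hp₂ : Function.Exact i₂ p₂)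
    {G : C₁ →ₗ[R] C₂} (hG : ∀ x, p₂ (g₁ x) = G (p₁ x)) (hp₁' : Function.Surjective p₁)
    (hf₂ : Function.Surjective f₂) (hg₁ : Function.Injective g₁) :
    ∃ d : K₃ →ₗ[R] C₁, Function.Exact F d ∧ Function.Exact d G :=
  ⟨SnakeLemma.δ' i₁ i₂ i₃ f₁ f₂ hf g₁ g₂ hg (LinearMap.ext fun x => (h₁ x).symm)
    (LinearMap.ext fun x => (h₂ x).symm) j₃ hj₃ p₁ hp₁ hf₂ hg₁,
  SnakeLemma.exact_δ'_right _ _ _ _ _ _ _ _ _ _ _ j₂ hj₂ _ _ _ _ _ _ _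
    (LinearMap.ext hF) hj₃',
  SnakeLemma.exact_δ'_left _ _ _ _ _ _ _ _ _ _ _ _ _ _ _ p₂ hp₂ _ _ _
    (LinearMap.ext fun x => (hG x).symm) hp₁'⟩

end Snake

section TorModule
open TensorProduct

variable {R : Type} [CommRing R]

/-- The short exact sequence attached to a surjection. -/
def SES.ofSurjective {P X : Type} [AddCommGroup X] [Module R X] [AddCommGroup P] [Module R P]
    (φ : P →ₗ[R] X) (hφ : Function.Surjective φ) : SES R (LinearMap.ker φ) P X where
  f := (LinearMap.ker φ).subtype
  g := φ
  inj := Submodule.subtype_injective _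
  surj := hφ
  exact := LinearMap.exact_subtype_ker_map _

theorem freeCounit_surjective (X : Type) [AddCommGroup X] [Module R X] :
    Function.Surjective (freeCounit (R := R) X) :=
  fun x => ⟨Finsupp.single x 1, (Finsupp.linearCombination_single R 1 x).trans (one_smul R x)⟩

variable {X X' X'' P : Type} [AddCommGroup X] [Module R X] [AddCommGroup X'] [Module R X']
  [AddCommGroup X''] [Module R X''] [AddCommGroup P] [Module R P]
  {Y Y' Y'' : Type} [AddCommGroup Y] [Module R Y] [AddCommGroup Y'] [Module R Y']
  [AddCommGroup Y''] [Module R Y'']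

theorem conn_injective [Module.Flat R X] (S : SES R X' X X'') (k : ℕ) :
    Function.Injective (conn Y S (k + 1)) := by
  have := subsingleton_torM_of_flat (R := R) (X := X) (Y := Y) k
  rw [injective_iff_map_eq_zero]
  intro z hz
  obtain ⟨w, rfl⟩ := (exact_torMap_conn Y S (k + 1) z).1 hz
  rw [Subsingleton.elim w 0, map_zero]

theorem conn_surjective [Module.Flat R X] (S : SES R X' X X'') (k : ℕ) :
    Function.Surjective (conn Y S (k + 2)) := by
  have := subsingleton_torM_of_flat (R := R) (X := X) (Y := Y) k
  intro z
  exact (exact_conn_torMap Y S (k + 2) z).1 (Subsingleton.elim _ _)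

theorem conn_torMap_right (S : SES R X' X X'') (k : ℕ) (η : Y →ₗ[R] Y')
    (z : torM R (k + 1) X'' Y) :
    conn Y' S k (torMap (k + 1) LinearMap.id η z) = torMap k LinearMap.id η (conn Y S k z) :=
  conn_naturality S S k LinearMap.id LinearMap.id LinearMap.id η rfl rfl z

theorem torMap_comm (k : ℕ) (f : X →ₗ[R] X') (g : Y →ₗ[R] Y') (z : torM R k X Y) :
    torMap k f (LinearMap.id : Y' →ₗ[R] Y') (torMap k (LinearMap.id : X →ₗ[R] X) g z) =
      torMap k (LinearMap.id : X' →ₗ[R] X') g (torMap k f (LinearMap.id : Y →ₗ[R] Y) z) := by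
  rw [torMap_torMap, torMap_torMap]
  rfl

theorem finite_torM_of_flat [IsNoetherianRing R] [Module.Flat R X] (S : SES R X' X X'') (k : ℕ)
    (h : Module.Finite R (torM R (k + 1) X' Y)) : Module.Finite R (torM R (k + 2) X'' Y) :=
  Module.Finite.of_injective _ (conn_injective (Y := Y) S k)

instance finite_torM [IsNoetherianRing R] [Module.Finite R Y] (k : ℕ) : ∀ (X : Type)
    [AddCommGroup X] [Module R X] [Module.Finite R X], Module.Finite R (torM R k X Y) := by
  match k with
  | 0 => intro X _ _ _; infer_instance
  | 1 => intro X _ _ _; exact Module.Finite.equiv (torMOne X Y).symm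
  | k + 2 =>
    intro X _ _ _
    obtain ⟨n, φ, hφ⟩ := Module.Finite.exists_fin' R X
    exact finite_torM_of_flat (SES.ofSurjective φ hφ) k (finite_torM (k + 1) (LinearMap.ker φ))

theorem smul_torM_eq_zero_left (k : ℕ) {r : R} (hr : ∀ x : X, r • x = 0) (z : torM R k X Y) :
    r • z = 0 := by
  apply Subtype.ext
  change r • (z : X ⊗[R] Syz R k Y) = 0
  generalize (z : X ⊗[R] Syz R k Y) = t
  induction t with
  | zero => exact smul_zero r
  | tmul x y => rw [TensorProduct.smul_tmul', hr, TensorProduct.zero_tmul]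
  | add a b ha hb => rw [smul_add, ha, hb, add_zero]

theorem smul_torM_eq_zero_right {r : R} (hr : ∀ y : Y, r • y = 0) (k : ℕ) : ∀ (X : Type)
    [AddCommGroup X] [Module R X] (z : torM R k X Y), r • z = 0 := by
  match k with
  | 0 => intro X _ _ z; exact Subsingleton.elim _ _
  | 1 =>
    intro X _ _ z
    apply (torMOne X Y).injective
    rw [map_smul, map_zero]
    generalize torMOne X Y z = t
    induction t with
    | zero => exact smul_zero r
    | tmul x y => rw [← TensorProduct.tmul_smul, hr, TensorProduct.tmul_zero]
    | add a b ha hb => rw [smul_add, ha, hb, add_zero]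
  | k + 2 =>
    intro X _ _ z
    apply conn_injective (Y := Y) (SES.ofSurjective _ (freeCounit_surjective (R := R) X)) k
    rw [map_smul, map_zero]
    exact smul_torM_eq_zero_right hr (k + 1) _ _

theorem torMap_one_exact_right (X : Type) [AddCommGroup X] [Module R X] (S : SES R Y' Y Y'') :
    Function.Exact (torMap 1 (LinearMap.id : X →ₗ[R] X) S.f)
      (torMap 1 (LinearMap.id : X →ₗ[R] X) S.g) := by
  have h := lTensor_exact X S.exact S.surj
  intro z
  rw [← (torMOne X Y'').injective.eq_iff, torMOne_naturality, map_zero]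
  refine (h _).trans ⟨?_, ?_⟩
  · rintro ⟨w, hw⟩
    exact ⟨(torMOne X Y').symm w, (torMOne X Y).injective hw⟩
  · rintro ⟨w, rfl⟩
    exact ⟨torMOne X Y' w, rfl⟩

theorem torMap_one_surjective_right (X : Type) [AddCommGroup X] [Module R X] (S : SES R Y' Y Y'') :
    Function.Surjective (torMap 1 (LinearMap.id : X →ₗ[R] X) S.g) := by
  intro z
  obtain ⟨w, hw⟩ := LinearMap.lTensor_surjective X S.surj (torMOne _ _ z)
  exact ⟨(torMOne _ _).symm w, (torMOne _ _).injective hw⟩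

theorem torMap_right_injective_of_flat [Module.Flat R X] (S : SES R Y' Y Y'') : ∀ k : ℕ,
    Function.Injective (torMap k (LinearMap.id : X →ₗ[R] X) S.f)
  | 0 => Function.injective_of_subsingleton _
  | 1 => fun z w h => (torMOne X Y').injective
      (Module.Flat.lTensor_preserves_injective_linearMap S.f S.inj (congrArg (torMOne X Y) h))
  | k + 2 => by
    have := subsingleton_torM_of_flat (R := R) (X := X) (Y := Y') k
    exact Function.injective_of_subsingleton _

theorem exists_conn_right_one_of_flat [Module.Flat R X] (F : SES R X' X X'') (S : SES R Y' Y Y'') :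
    ∃ d : torM R 2 X'' Y'' →ₗ[R] torM R 1 X'' Y',
      Function.Exact (torMap 2 (LinearMap.id : X'' →ₗ[R] X'') S.f)
        (torMap 2 (LinearMap.id : X'' →ₗ[R] X'') S.g) ∧
      Function.Exact (torMap 2 (LinearMap.id : X'' →ₗ[R] X'') S.g) d ∧
      Function.Exact d (torMap 1 (LinearMap.id : X'' →ₗ[R] X'') S.f) := by
  have h₁ := fun z : torM R 1 X' Y' => torMap_comm 1 F.f S.f z
  have h₂ := fun z : torM R 1 X' Y => torMap_comm 1 F.f S.g z
  have h₃ := fun z : torM R 2 X'' Y => (conn_torMap_right F 1 S.g z).symm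
  have h₄ := fun z : torM R 1 X Y' => torMap_comm 1 F.g S.f z
  have hA := torMap_one_exact_right X' S
  have hB := torMap_one_exact_right X S
  have hs := torMap_one_surjective_right X' S
  have hi := torMap_right_injective_of_flat (X := X) S 1
  obtain ⟨d, hd, hd'⟩ := exists_snake _ _ _ hA hB h₁ h₂
    (exact_conn_torMap Y F 1) (exact_conn_torMap Y'' F 1) h₃
    (conn_injective (Y := Y'') F 0) (exact_torMap_torMap Y' F 0) (exact_torMap_torMap Y F 0)
    h₄ (torMap_one_surjective F) hs hi
  refine ⟨d, ?_, hd, hd'⟩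
  intro z
  constructor
  · intro hz
    have h1 := conn_torMap_right F 1 S.g z
    rw [hz, map_zero] at h1
    obtain ⟨w, hw⟩ := (torMap_one_exact_right _ S _).1 h1.symm
    have h2 : torMap 1 F.f LinearMap.id w = 0 := by
      apply torMap_right_injective_of_flat S 1
      rw [map_zero, ← torMap_comm, hw]
      exact (exact_conn_torMap Y F 1).apply_apply_eq_zero z
    obtain ⟨v, rfl⟩ := (exact_conn_torMap Y' F 1 _).1 h2
    refine ⟨v, conn_injective (Y := Y) F 0 ?_⟩
    rw [← hw]
    exact conn_torMap_right F 1 S.f v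
  · rintro ⟨w, rfl⟩
    apply conn_injective (Y := Y'') F 0
    change conn Y'' F 1 _ = conn Y'' F 1 _
    rw [map_zero, conn_torMap_right, conn_torMap_right]
    exact (torMap_one_exact_right _ S).apply_apply_eq_zero _

theorem exists_conn_right_one (X : Type) [AddCommGroup X] [Module R X] (S : SES R Y' Y Y'') :
    ∃ d : torM R 2 X Y'' →ₗ[R] torM R 1 X Y',
      Function.Exact (torMap 2 (LinearMap.id : X →ₗ[R] X) S.f)
        (torMap 2 (LinearMap.id : X →ₗ[R] X) S.g) ∧
      Function.Exact (torMap 2 (LinearMap.id : X →ₗ[R] X) S.g) d ∧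
      Function.Exact d (torMap 1 (LinearMap.id : X →ₗ[R] X) S.f) :=
  exists_conn_right_one_of_flat (SES.ofSurjective _ (freeCounit_surjective (R := R) X)) S

theorem exists_conn_right (k : ℕ) (S : SES R Y' Y Y'') : ∀ (X : Type) [AddCommGroup X]
    [Module R X], ∃ d : torM R (k + 1) X Y'' →ₗ[R] torM R k X Y',
      Function.Exact (torMap (k + 1) (LinearMap.id : X →ₗ[R] X) S.f)
        (torMap (k + 1) (LinearMap.id : X →ₗ[R] X) S.g) ∧
      Function.Exact (torMap (k + 1) (LinearMap.id : X →ₗ[R] X) S.g) d ∧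
      Function.Exact d (torMap k (LinearMap.id : X →ₗ[R] X) S.f) := by
  match k with
  | 0 =>
    intro X _ _
    exact ⟨0, torMap_one_exact_right X S, fun z => ⟨fun _ => torMap_one_surjective_right X S z,
      fun _ => rfl⟩, fun z => ⟨fun _ => ⟨0, Subsingleton.elim _ _⟩, fun _ => Subsingleton.elim _ _⟩⟩
  | 1 =>
    intro X _ _
    exact exists_conn_right_one X S
  | l + 2 =>
    intro X _ _
    let F := SES.ofSurjective _ (freeCounit_surjective (R := R) X)
    obtain ⟨d', h1, h2, h3⟩ := exists_conn_right (l + 1) S (LinearMap.ker (freeCounit (R := R) X))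
    have hi := fun k => conn_injective (Y := Y) F k
    have hi' := fun k => conn_injective (Y := Y') F k
    have hi'' := fun k => conn_injective (Y := Y'') F k
    have hrange : ∀ z, (d' ∘ₗ conn Y'' F (l + 2)) z ∈ LinearMap.range (conn Y' F (l + 1)) := by
      intro z
      refine (exact_conn_torMap Y' F (l + 1) _).1 ?_
      apply torMap_right_injective_of_flat S (l + 1)
      rw [map_zero, ← torMap_comm, LinearMap.comp_apply, h3.apply_apply_eq_zero, map_zero]
    let e := LinearEquiv.ofInjective _ (hi' l)
    let d : torM R (l + 3) X Y'' →ₗ[R] torM R (l + 2) X Y' :=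
      e.symm.toLinearMap ∘ₗ (d' ∘ₗ conn Y'' F (l + 2)).codRestrict _ hrange
    have hd : ∀ z, conn Y' F (l + 1) (d z) = d' (conn Y'' F (l + 2) z) := fun z =>
      congrArg Subtype.val (e.apply_symm_apply
        ((d' ∘ₗ conn Y'' F (l + 2)).codRestrict _ hrange z))
    refine ⟨d, fun z => ⟨fun hz => ?_, ?_⟩, fun z => ⟨fun hz => ?_, ?_⟩, fun z => ⟨fun hz => ?_, ?_⟩⟩
    · have h := conn_torMap_right F (l + 2) S.g z
      rw [hz, map_zero] at h
      obtain ⟨w, hw⟩ := (h1 _).1 h.symm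
      obtain ⟨v, rfl⟩ := conn_surjective (Y := Y') F l w
      exact ⟨v, hi (l + 1) ((conn_torMap_right F (l + 2) S.f v).trans hw)⟩
    · rintro ⟨w, rfl⟩
      apply hi'' (l + 1)
      change conn Y'' F (l + 2) _ = conn Y'' F (l + 2) _
      rw [map_zero, conn_torMap_right, conn_torMap_right]
      exact h1.apply_apply_eq_zero _
    · have h := hd z
      rw [hz, map_zero] at h
      obtain ⟨w, hw⟩ := (h2 _).1 h.symm
      obtain ⟨v, rfl⟩ := conn_surjective (Y := Y) F l w
      exact ⟨v, hi'' (l + 1) ((conn_torMap_right F (l + 2) S.g v).trans hw)⟩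
    · rintro ⟨w, rfl⟩
      apply hi' l
      rw [hd, map_zero, conn_torMap_right]
      exact h2.apply_apply_eq_zero _
    · have h := conn_torMap_right F (l + 1) S.f z
      rw [hz, map_zero] at h
      obtain ⟨w, hw⟩ := (h3 _).1 h.symm
      obtain ⟨v, rfl⟩ := conn_surjective (Y := Y'') F l w
      exact ⟨v, hi' l ((hd v).trans hw)⟩
    · rintro ⟨w, rfl⟩
      apply hi l
      rw [map_zero, conn_torMap_right, hd]
      exact h3.apply_apply_eq_zero _

end TorModule

section TorFamily

variable {R : Type} [CommRing R] {ι κ : Type}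
  {X : ℕ → Type} [∀ g, AddCommGroup (X g)] [∀ g, Module R (X g)]
  {Y : ℕ → Type} [∀ g, AddCommGroup (Y g)] [∀ g, Module R (Y g)]

/-- The operators on the bigraded family of `Tor` modules. -/
noncomputable def torOp (k : ℕ) (opX : ∀ (s : ι) (m : ℕ), X m →ₗ[R] X (sh1 ι s m))
    (opY : ∀ (s : κ) (m : ℕ), Y m →ₗ[R] Y (sh1 κ s m)) :
    ∀ (s : ι ⊕ κ) (g : ℕ × ℕ), torM R k (X g.1) (Y g.2) →ₗ[R]
      torM R k (X (sh2 ι κ s g).1) (Y (sh2 ι κ s g).2)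
  | .inl i, g => torMap k (opX i g.1) LinearMap.id
  | .inr j, g => torMap k LinearMap.id (opY j g.2)

theorem opComm_of_comm {opX : ∀ (s : ι) (m : ℕ), X m →ₗ[R] X (sh1 ι s m)}
    (hX : ∀ s t m x, opX s (m + 1) (opX t m x) = opX t (m + 1) (opX s m x)) : OpComm opX :=
  fun s t m x => congrArg (DirectSum.lof R ℕ X (m + 1 + 1)) (hX s t m x)

theorem torOp_mixedComm (k : ℕ) (opX : ∀ (s : ι) (m : ℕ), X m →ₗ[R] X (sh1 ι s m))
    (opY : ∀ (s : κ) (m : ℕ), Y m →ₗ[R] Y (sh1 κ s m)) :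
    MixedComm (X := fun g : ℕ × ℕ => torM R k (X g.1) (Y g.2)) (torOp k opX opY) :=
  fun i j m n x => torMap_comm k (opX i m) (opY j n) x

theorem noe_torOp [IsNoetherianRing R] [Finite ι] [Finite κ]
    {opY : ∀ (s : κ) (m : ℕ), Y m →ₗ[R] Y (sh1 κ s m)} (hY : FG opY)
    (hYc : ∀ s t m x, opY s (m + 1) (opY t m x) = opY t (m + 1) (opY s m x)) (k : ℕ) :
    ∀ {X : ℕ → Type} [∀ g, AddCommGroup (X g)] [∀ g, Module R (X g)]
    {opX : ∀ (s : ι) (m : ℕ), X m →ₗ[R] X (sh1 ι s m)} (_ : FG opX)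
    (_ : ∀ s t m x, opX s (m + 1) (opX t m x) = opX t (m + 1) (opX s m x)),
    Noe (X := fun g : ℕ × ℕ => torM R k (X g.1) (Y g.2)) (torOp k opX opY) := by
  match k with
  | 0 =>
    intro X _ _ opX _ _
    have : Subsingleton {Z : ∀ g : ℕ × ℕ, Submodule R (torM R 0 (X g.1) (Y g.2)) //
        Stable (torOp 0 opX opY) Z} := ⟨fun Z Z' => Subtype.ext (funext fun g =>
          Subsingleton.elim _ _)⟩
    exact Finite.to_wellFoundedGT
  | 1 =>
    intro X _ _ opX hX hXc
    refine Noe.of_injective ((hX.tensor hY).noe (tensorOp_comm hXc hYc))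
      (fun g => (torMOne (X g.1) (Y g.2)).toLinearMap)
      (fun g => (torMOne (X g.1) (Y g.2)).injective) ?_
    rintro (s | s) g x <;> rfl
  | k + 2 =>
    intro X _ _ opX hX hXc
    obtain ⟨P, _, _, opP, φ, hflat, hP, hPc, hφ, hφc⟩ := exists_flat_cover hX hXc
    let K : ℕ → Type := fun m => LinearMap.ker (φ m)
    let opK : ∀ (s : ι) (m : ℕ), LinearMap.ker (φ m) →ₗ[R] LinearMap.ker (φ (sh1 ι s m)) :=
      fun s m => (opP s m).restrict fun x hx => by
        rw [LinearMap.mem_ker] at hx ⊢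
        rw [hφc, hx, map_zero]
    have hK : FG opK := ((hP.noe (opComm_of_comm hPc)).of_injective
      (fun m => (LinearMap.ker (φ m)).subtype) (fun m => Submodule.subtype_injective _)
      (fun _ _ _ => rfl)).fg
    have ih := noe_torOp hY hYc (k + 1) (X := fun m => LinearMap.ker (φ m)) hK
      (fun s t m x => Subtype.ext (hPc s t m x))
    refine ih.of_injective
      (fun g => conn (Y g.2) (SES.ofSurjective (φ g.1) (hφ g.1)) (k + 1))
      (fun g => conn_injective _ k) ?_
    rintro (s | s) g x
    · exact conn_naturality (SES.ofSurjective (φ g.1) (hφ g.1))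
        (SES.ofSurjective (φ (g.1 + 1)) (hφ (g.1 + 1))) (k + 1) (opK s g.1) (opP s g.1)
        (opX s g.1) LinearMap.id rfl (LinearMap.ext fun x => (hφc s g.1 x).symm) x
    · exact conn_torMap_right _ _ _ _

end TorFamily

section Comparison
open TensorProduct

variable {R : Type} [CommRing R]

theorem ShortComplex.nonempty_homology_equiv (S : ShortComplex (ModuleCat.{0} R)) {Q : Type}
    [AddCommGroup Q] [Module R Q] (T : Submodule R Q) (π : S.X₂ →ₗ[R] Q)
    (hπ : Function.Surjective π) (hf : Function.Exact S.f.hom π)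
    (hg : ∀ x, S.g.hom x = 0 ↔ π x ∈ T) : Nonempty (S.homology ≃ₗ[R] T) := by
  let e₁ := S.moduleCatHomologyIso.toLinearEquiv
  let ρ : LinearMap.ker S.g.hom →ₗ[R] T :=
    π.restrict fun x hx => (hg x).1 hx
  have hρ : Function.Surjective ρ := by
    rintro ⟨y, hy⟩
    obtain ⟨x, rfl⟩ := hπ y
    exact ⟨⟨x, (hg x).2 hy⟩, rfl⟩
  have hker : LinearMap.range S.moduleCatToCycles = LinearMap.ker ρ := by
    ext ⟨x, hx⟩
    have : ρ ⟨x, hx⟩ = 0 ↔ π x = 0 := Subtype.ext_iff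
    rw [LinearMap.mem_ker, this, hf x]
    constructor
    · rintro ⟨y, hy⟩
      exact ⟨y, congrArg Subtype.val hy⟩
    · rintro ⟨y, hy⟩
      exact ⟨y, Subtype.ext hy⟩
  exact ⟨e₁.trans ((Submodule.quotEquivOfEq _ _ hker).trans (ρ.quotKerEquivOfSurjective hρ))⟩

variable (R) (Y : Type) [AddCommGroup Y] [Module R Y]

/-- The differential of the functorial free resolution. -/
noncomputable def resD (k : ℕ) : Res R (k + 1) Y →ₗ[R] Res R k Y := syzIncl R Y k ∘ₗ resProj R Y k

theorem exact_resD (k : ℕ) : Function.Exact (resD R Y (k + 3)) (resD R Y (k + 2)) := by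
  intro x
  have : resD R Y (k + 2) x = 0 ↔ resProj R Y (k + 2) x = 0 := by
    rw [← map_zero (syzIncl R Y (k + 2))]
    exact (syzIncl_injective R Y k).eq_iff
  rw [this, exact_syzIncl_resProj R Y (k + 2) x]
  constructor
  · rintro ⟨y, rfl⟩
    obtain ⟨z, rfl⟩ := resProj_surjective R Y (k + 3) y
    exact ⟨z, rfl⟩
  · rintro ⟨y, rfl⟩
    exact ⟨resProj R Y (k + 3) y, rfl⟩

theorem exact_resD_resProj : Function.Exact (resD R Y 2) (resProj R Y 1) := by
  intro x
  rw [exact_syzIncl_resProj R Y 1 x]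
  constructor
  · rintro ⟨y, rfl⟩
    obtain ⟨z, rfl⟩ := resProj_surjective R Y 2 y
    exact ⟨z, rfl⟩
  · rintro ⟨y, rfl⟩
    exact ⟨resProj R Y 2 y, rfl⟩

/-- The functorial free resolution as a chain complex. -/
noncomputable def resComplex : ChainComplex (ModuleCat.{0} R) ℕ :=
  ChainComplex.of (fun n => ModuleCat.of R (Res R (n + 2) Y))
    (fun n => ModuleCat.ofHom (resD R Y (n + 2)))
    (fun n => by ext x; exact (exact_resD R Y n).apply_apply_eq_zero x)

theorem resComplex_d (n : ℕ) :
    (resComplex R Y).d (n + 1) n = ModuleCat.ofHom (resD R Y (n + 2)) :=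
  ChainComplex.of_d (fun n => ModuleCat.of R (Res R (n + 2) Y))
    (fun n => ModuleCat.ofHom (resD R Y (n + 2))) n

/-- The functorial free resolution as a projective resolution. -/
noncomputable def resResolution : ProjectiveResolution (ModuleCat.of R Y) where
  complex := resComplex R Y
  projective n := ModuleCat.projective_of_categoryTheory_projective
    (ModuleCat.of R (Syz R (n + 1) Y →₀ R))
  π := (ChainComplex.toSingle₀Equiv _ _).symm ⟨ModuleCat.ofHom (resProj R Y 1), by
    rw [resComplex_d]
    ext x
    exact (exact_resD_resProj R Y).apply_apply_eq_zero x⟩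
  quasiIso := ⟨fun n => by
    cases n with
    | zero =>
      rw [ChainComplex.quasiIsoAt₀_iff, ShortComplex.quasiIso_iff_of_zeros']
      · refine ⟨(ShortComplex.moduleCat_exact_iff _).2 fun x hx => ?_,
          (ModuleCat.epi_iff_surjective _).2 ?_⟩
        · have h1 : resProj R Y 1 x = 0 := hx
          obtain ⟨y, hy⟩ := (exact_resD_resProj R Y x).1 h1
          refine ⟨y, ?_⟩
          change ((resComplex R Y).d 1 0).hom y = x
          rw [resComplex_d]
          exact hy
        · exact resProj_surjective R Y 1
      all_goals rfl
    | succ n =>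
      rw [quasiIsoAt_iff_exactAt']
      · rw [HomologicalComplex.exactAt_iff' _ (n + 1 + 1) (n + 1) n (by simp) (by simp),
          ShortComplex.moduleCat_exact_iff]
        intro x hx
        have h1 : ((resComplex R Y).d (n + 1) n).hom x = 0 := hx
        rw [resComplex_d] at h1
        obtain ⟨y, hy⟩ := (exact_resD R Y n x).1 h1
        refine ⟨y, ?_⟩
        change ((resComplex R Y).d (n + 1 + 1) (n + 1)).hom y = x
        rw [resComplex_d]
        exact hy
      · apply ChainComplex.exactAt_succ_single_obj⟩

variable (X : Type) [AddCommGroup X] [Module R X]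

theorem nonempty_torM_equiv (i : ℕ) : Nonempty (TorM R i X Y ≃ₗ[R] torM R (i + 1) X Y) := by
  let F := (MonoidalCategory.tensoringLeft (ModuleCat.{0} R)).obj (ModuleCat.of R X)
  let K := (F.mapHomologicalComplex (ComplexShape.down ℕ)).obj (resComplex R Y)
  have hK : ∀ n, (K.d (n + 1) n).hom = (resD R Y (n + 2)).lTensor X := by
    intro n
    change (F.map ((resComplex R Y).d (n + 1) n)).hom = _
    rw [resComplex_d]
    rfl
  obtain ⟨k, hk, hg⟩ : ∃ k, (ComplexShape.down ℕ).next i = k ∧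
      ∀ x : X ⊗[R] Res R (i + 2) Y, (K.d i k).hom x = 0 ↔
        (resProj R Y (i + 1)).lTensor X x ∈ torM R (i + 1) X Y := by
    cases i with
    | zero =>
      refine ⟨0, by simp, fun x => ⟨fun _ => ?_, fun _ => ?_⟩⟩
      · exact ((torMOne X Y).symm _).2
      · rw [K.shape 0 0 (by simp)]
        rfl
    | succ n =>
      refine ⟨n, by simp, fun x => ?_⟩
      rw [hK, resD, LinearMap.lTensor_comp]
      rfl
  have hf : Function.Exact (K.sc' (i + 1) i k).f.hom ((resProj R Y (i + 1)).lTensor X) := by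
    change Function.Exact (K.d (i + 1) i).hom _
    rw [hK]
    refine lTensor_exact X (fun x => ?_) (resProj_surjective R Y (i + 1))
    rw [exact_syzIncl_resProj R Y (i + 1) x]
    constructor
    · rintro ⟨y, rfl⟩
      obtain ⟨z, rfl⟩ := resProj_surjective R Y (i + 2) y
      exact ⟨z, rfl⟩
    · rintro ⟨y, rfl⟩
      exact ⟨resProj R Y (i + 2) y, rfl⟩
  obtain ⟨e⟩ := ShortComplex.nonempty_homology_equiv (K.sc' (i + 1) i k) (torM R (i + 1) X Y)
    ((resProj R Y (i + 1)).lTensor X) (LinearMap.lTensor_surjective X (resProj_surjective R Y _))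
    hf hg
  let e₁ : TorM R i X Y ≅ K.homology i := (resResolution R Y).isoLeftDerivedObj F i
  let e₂ : K.homology i ≅ (K.sc' (i + 1) i k).homology :=
    ShortComplex.homologyMapIso (K.isoSc' (i + 1) i k (by simp) hk)
  exact ⟨(e₁ ≪≫ e₂).toLinearEquiv.trans e⟩

theorem modLength_torM (i : ℕ) :
    modLength R (TorM R i X Y) = Module.length R (torM R (i + 1) X Y) := by
  obtain ⟨e⟩ := nonempty_torM_equiv R Y X i
  rw [← e.length_eq, Module.coe_length, modLength]

end Comparison

section Tower

variable {R : Type} [CommRing R] {ι : Type} {a : ι → R}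
  {T : ℕ × ℕ → Type} [∀ g, AddCommGroup (T g)] [∀ g, Module R (T g)]

variable (a T) in
/-- A Noetherian bigraded family whose operators are induced by multiplication by `a i`, with
transition maps to the boundary. -/
structure Tower where
  /-- the operators -/
  op : ∀ (s : ι ⊕ ι) (g : ℕ × ℕ), T g →ₗ[R] T (sh2 ι ι s g)
  /-- the transition map to degree zero in the first variable -/
  p : ∀ m n, T (m, n) →ₗ[R] T (0, n)
  /-- the transition map to degree zero in the second variable -/
  q : ∀ m n, T (m, n) →ₗ[R] T (m, 0)
  /-- the transition map decreasing the first degree by one -/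
  s : ∀ m n, T (m + 1, n) →ₗ[R] T (m, n)
  /-- the transition map decreasing the second degree by one -/
  t : ∀ m n, T (m, n + 1) →ₗ[R] T (m, n)
  noe : Noe op
  comm_inl : ∀ i j m n (x : T (m, n)),
    op (.inl i) (m + 1, n) (op (.inl j) (m, n) x) = op (.inl j) (m + 1, n) (op (.inl i) (m, n) x)
  comm_inr : ∀ i j m n (x : T (m, n)),
    op (.inr i) (m, n + 1) (op (.inr j) (m, n) x) = op (.inr j) (m, n + 1) (op (.inr i) (m, n) x)
  mixed : MixedComm op
  p_inl : ∀ i m n (x : T (m, n)), p (m + 1) n (op (.inl i) (m, n) x) = a i • p m n x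
  p_inr : ∀ i m n (x : T (m, n)),
    p m (n + 1) (op (.inr i) (m, n) x) = op (.inr i) (0, n) (p m n x)
  q_inr : ∀ i m n (x : T (m, n)), q m (n + 1) (op (.inr i) (m, n) x) = a i • q m n x
  q_inl : ∀ i m n (x : T (m, n)),
    q (m + 1) n (op (.inl i) (m, n) x) = op (.inl i) (m, 0) (q m n x)
  p_zero : ∀ n (x : T (0, n)), p 0 n x = x
  q_zero : ∀ m (x : T (m, 0)), q m 0 x = x
  q_p : ∀ m n (x : T (m, n)), q 0 n (p m n x) = p m 0 (q m n x)
  p_s : ∀ m n (x : T (m + 1, n)), p m n (s m n x) = p (m + 1) n x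
  q_s : ∀ m n (x : T (m + 1, n)), q m n (s m n x) = s m 0 (q (m + 1) n x)
  q_t : ∀ m n (x : T (m, n + 1)), q m n (t m n x) = q m (n + 1) x
  p_t : ∀ m n (x : T (m, n + 1)), p m n (t m n x) = t 0 n (p m (n + 1) x)

namespace Tower

variable (τ : Tower a T)

/-- Exchange the two gradings of a tower. -/
def swap : Tower (T := fun g : ℕ × ℕ => T g.swap) a where
  op := swapOp τ.op
  p m n := τ.q n m
  q m n := τ.p n m
  s m n := τ.t n m
  t m n := τ.s n m
  noe := τ.noe.swap
  comm_inl i j m n x := τ.comm_inr i j n m x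
  comm_inr i j m n x := τ.comm_inl i j n m x
  mixed := τ.mixed.swap
  p_inl i m n x := τ.q_inr i n m x
  p_inr i m n x := τ.q_inl i n m x
  q_inr i m n x := τ.p_inl i n m x
  q_inl i m n x := τ.p_inr i n m x
  p_zero n x := τ.q_zero n x
  q_zero m x := τ.p_zero m x
  q_p m n x := (τ.q_p n m x).symm
  p_s m n x := τ.q_t n m x
  q_s m n x := τ.p_t n m x
  q_t m n x := τ.p_s n m x
  p_t m n x := τ.q_s n m x

theorem opComm : OpComm τ.op := by
  rintro (i | i) (j | j) ⟨m, n⟩ x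
  · exact congrArg (DirectSum.lof R (ℕ × ℕ) T (m + 1 + 1, n)) (τ.comm_inl i j m n x)
  · exact congrArg (DirectSum.lof R (ℕ × ℕ) T (m + 1, n + 1)) (τ.mixed i j m n x)
  · exact congrArg (DirectSum.lof R (ℕ × ℕ) T (m + 1, n + 1)) (τ.mixed j i m n x).symm
  · exact congrArg (DirectSum.lof R (ℕ × ℕ) T (m, n + 1 + 1)) (τ.comm_inr i j m n x)

/-- The kernels of the transition map in the first variable. -/
def kerP : ∀ g : ℕ × ℕ, Submodule R (T g) := fun g => LinearMap.ker (τ.p g.1 g.2)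

/-- The kernels of the transition map in the second variable. -/
def kerQ : ∀ g : ℕ × ℕ, Submodule R (T g) := fun g => LinearMap.ker (τ.q g.1 g.2)

/-- The kernels of the transition map to degree zero. -/
def kerQP : ∀ g : ℕ × ℕ, Submodule R (T g) :=
  fun g => LinearMap.ker (τ.q 0 g.2 ∘ₗ τ.p g.1 g.2)

theorem stable_kerP : Stable τ.op τ.kerP := by
  rintro (i | i) ⟨m, n⟩ x hx
  · exact (τ.p_inl i m n x).trans ((congrArg (a i • ·) hx).trans (smul_zero _))
  · exact (τ.p_inr i m n x).trans ((congrArg (τ.op (.inr i) (0, n)) hx).trans (map_zero _))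

theorem stable_kerQ : Stable τ.op τ.kerQ := by
  rintro (i | i) ⟨m, n⟩ x hx
  · exact (τ.q_inl i m n x).trans ((congrArg (τ.op (.inl i) (m, 0)) hx).trans (map_zero _))
  · exact (τ.q_inr i m n x).trans ((congrArg (a i • ·) hx).trans (smul_zero _))

theorem q_p_op (s : ι ⊕ ι) (g : ℕ × ℕ) (x : T g) :
    ∃ r : R, r ∈ Set.range a ∧ τ.q 0 (sh2 ι ι s g).2 (τ.p (sh2 ι ι s g).1 (sh2 ι ι s g).2
      (τ.op s g x)) = r • τ.q 0 g.2 (τ.p g.1 g.2 x) := by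
  obtain ⟨m, n⟩ := g
  obtain i | i := s
  · exact ⟨a i, ⟨i, rfl⟩, (congrArg (τ.q 0 n) (τ.p_inl i m n x)).trans (map_smul _ _ _)⟩
  · exact ⟨a i, ⟨i, rfl⟩, (congrArg (τ.q 0 (n + 1)) (τ.p_inr i m n x)).trans
      (τ.q_inr i 0 n _)⟩

theorem stable_kerQP : Stable τ.op τ.kerQP := by
  intro s g x hx
  obtain ⟨r, -, h⟩ := τ.q_p_op s g x
  exact h.trans ((congrArg (r • ·) hx).trans (smul_zero r))

theorem length_inf_mem_eventuallyPoly [Finite ι]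
    (hfin : ∀ m n, Module.length R ↥(τ.kerP (m, n) ⊓ τ.kerQ (m, n)) ≠ ⊤) :
    (fun n => ((Module.length R ↥(τ.kerP (n, n) ⊓ τ.kerQ (n, n))).toNat : ℚ)) ∈
      eventuallyPoly := by
  have h := τ.noe.relLen_mem_biPoly τ.opComm (A := fun _ => ⊥)
    (B := fun g => τ.kerP g ⊓ τ.kerQ g) (fun s g x hx => by
      rw [Submodule.mem_bot] at hx ⊢
      rw [hx, map_zero]) (fun s g x hx => ⟨τ.stable_kerP s g x hx.1, τ.stable_kerQ s g x hx.2⟩)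
    (fun _ => bot_le) (fun g => by rw [relLen_bot]; exact hfin g.1 g.2)
  simp only [relLen_bot] at h
  exact biPoly_diag h

theorem relLen_map_q_mem_eventuallyPoly [Finite ι] {S : ∀ g, Submodule R (T g)}
    (hS : Stable τ.op S) (ht : ∀ m n, ∀ x ∈ S (m, n + 1), τ.t m n x ∈ S (m, n))
    (hfin : ∀ m, Module.length R (S (m, 0)) ≠ ⊤) :
    (fun n => ((relLen ((S (n, n)).map (τ.q n n)) (S (n, 0))).toNat : ℚ)) ∈ eventuallyPoly := by
  let D : ∀ m n, Submodule R (T (m, 0)) := fun m n => (S (m, n)).map (τ.q m n)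
  have hD0 : ∀ m, D m 0 = S (m, 0) := by
    intro m
    have : τ.q m 0 = LinearMap.id := LinearMap.ext (τ.q_zero m)
    change (S (m, 0)).map (τ.q m 0) = _
    rw [this, Submodule.map_id]
  have hDle : ∀ m n, D m (n + 1) ≤ D m n := by
    rintro m n _ ⟨x, hx, rfl⟩
    exact ⟨_, ht m n x hx, τ.q_t m n x⟩
  have hD : ∀ m n, D m n ≤ S (m, 0) := by
    intro m n
    induction n with
    | zero => exact (hD0 m).le
    | succ n ih => exact (hDle m n).trans ih
  have hlen : ∀ m n, relLen (D m (n + 1)) (D m n) ≠ ⊤ := by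
    intro m n h
    apply hfin m
    rw [← top_le_iff, ← h, ← relLen_bot]
    exact relLen_mono bot_le (hDle m n) (hD m n)
  have key : ∀ m n, relLen (S (m, n) ⊓ (D m (n + 1)).comap (τ.q m n)) (S (m, n)) =
      relLen (D m (n + 1)) (D m n) := by
    intro m n
    rw [relLen_comap]
    exact congrArg _ (sup_eq_right.2 (hDle m n))
  have h := τ.noe.relLen_mem_biPoly τ.opComm
    (A := fun g => S g ⊓ (D g.1 (g.2 + 1)).comap (τ.q g.1 g.2)) (B := S) (by
      rintro (i | i) ⟨m, n⟩ x ⟨hx, y, hy, hyx⟩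
      · refine ⟨hS _ _ x hx, τ.op (.inl i) (m, n + 1) y, hS (.inl i) (m, n + 1) y hy, ?_⟩
        exact (τ.q_inl i m (n + 1) y).trans ((congrArg _ hyx).trans (τ.q_inl i m n x).symm)
      · refine ⟨hS _ _ x hx, τ.op (.inr i) (m, n + 1) y, hS (.inr i) (m, n + 1) y hy, ?_⟩
        exact (τ.q_inr i m (n + 1) y).trans ((congrArg _ hyx).trans (τ.q_inr i m n x).symm))
    hS (fun _ => inf_le_left) (fun g => by rw [key g.1 g.2]; exact hlen g.1 g.2)
  have h2 := biPoly_sum h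
  convert h2 using 2 with n
  have hsum : ∀ l, relLen (D n l) (S (n, 0)) ≠ ⊤ ∧ ((relLen (D n l) (S (n, 0))).toNat : ℚ) =
      ∑ k ∈ Finset.range l, ((relLen (D n (k + 1)) (D n k)).toNat : ℚ) := by
    intro l
    induction l with
    | zero => rw [hD0, relLen_self]; simp
    | succ l ih =>
      rw [relLen_add (hDle n l) (hD n l), Finset.sum_range_succ, ← ih.2,
        ENat.toNat_add (hlen n l) ih.1]
      refine ⟨WithTop.add_ne_top.2 ⟨hlen n l, ih.1⟩, ?_⟩
      push_cast
      ring
  exact (hsum n).2.trans (Finset.sum_congr rfl fun k _ =>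
    congrArg (fun x : ℕ∞ => (x.toNat : ℚ)) (key n k).symm)

end Tower

end Tower

section HilbertSamuel

variable {R : Type} [CommRing R] {ι : Type} {K : Type} [AddCommGroup K] [Module R K]

/-- Multiplication by `a i` on the filtration by powers of the ideal spanned by `a`. -/
def powOp (a : ι → R) (F : Submodule R K) (i : ι) (m : ℕ) :
    ↥(Ideal.span (Set.range a) ^ m • F) →ₗ[R] ↥(Ideal.span (Set.range a) ^ (sh1 ι i m) • F) :=
  (a i • LinearMap.id).restrict fun x hx => by
    change a i • x ∈ Ideal.span (Set.range a) ^ (m + 1) • F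
    rw [pow_succ', ← smul_eq_mul, Submodule.smul_assoc]
    exact Submodule.smul_mem_smul (Ideal.subset_span ⟨i, rfl⟩) hx

theorem powOp_comm (a : ι → R) (F : Submodule R K) (s t : ι) (m : ℕ)
    (x : ↥(Ideal.span (Set.range a) ^ m • F)) :
    powOp a F s (m + 1) (powOp a F t m x) = powOp a F t (m + 1) (powOp a F s m x) :=
  Subtype.ext (smul_comm (a s) (a t) (x : K))

theorem fg_powOp (a : ι → R) {F : Submodule R K} (hF : F.FG) : FG (powOp a F) := by
  obtain ⟨S, rfl⟩ := hF
  set F := Submodule.span R (S : Set K) with hFdef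
  refine ⟨S, inferInstance, fun _ => 0, fun k => ⟨k, ?_⟩, fun Z hZ he => ?_⟩
  · rw [pow_zero, Ideal.one_eq_top, Submodule.top_smul]
    exact Submodule.subset_span k.2
  · have key : ∀ m, Ideal.span (Set.range a) ^ m • F ≤ (Z m).map (Submodule.subtype _) := by
      intro m
      induction m with
      | zero =>
        refine Submodule.smul_le_right.trans (Submodule.span_le.2 ?_)
        exact fun x hx => ⟨_, he ⟨x, hx⟩, rfl⟩
      | succ m ih =>
        have hs : Ideal.span (Set.range a) ^ (m + 1) • F =
            Ideal.span (Set.range a) • Ideal.span (Set.range a) ^ m • F := by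
          rw [pow_succ', ← smul_eq_mul, Submodule.smul_assoc]
        refine (hs.le.trans (Submodule.smul_mono le_rfl ih)).trans ?_
        rw [Submodule.smul_le]
        intro r hr x hx
        induction hr using Submodule.span_induction with
        | mem r hr =>
          obtain ⟨i, rfl⟩ := hr
          obtain ⟨y, hy, rfl⟩ := hx
          exact ⟨_, hZ i m y hy, rfl⟩
        | zero => rw [zero_smul]; exact Submodule.zero_mem _
        | add r r' _ _ h h' => rw [add_smul]; exact Submodule.add_mem _ h h'
        | smul c r _ h => rw [smul_assoc]; exact Submodule.smul_mem _ c h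
    intro m
    rw [eq_top_iff]
    rintro ⟨x, hx⟩ -
    obtain ⟨y, hy, rfl⟩ := key m hx
    exact hy

theorem fg_idOp : FG (R := R) (σ := Unit) (sh := sh1 Unit) (X := fun _ : ℕ => R)
    (fun _ _ => LinearMap.id) := by
  refine ⟨Unit, inferInstance, fun _ => 0, fun _ => (1 : R), fun Z hZ he => ?_⟩
  have h : ∀ m, (1 : R) ∈ Z m := by
    intro m
    induction m with
    | zero => exact he ()
    | succ m ih => exact hZ () m 1 ih
  exact fun m => (Ideal.eq_top_iff_one (Z m)).2 (h m)

theorem relLen_pow_smul_mem_eventuallyPoly [IsNoetherianRing R] [Finite ι] (a : ι → R)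
    {F : Submodule R K} (hF : F.FG)
    (hfin : ∀ n, relLen (Ideal.span (Set.range a) ^ n • F) F ≠ ⊤) :
    (fun n => ((relLen (Ideal.span (Set.range a) ^ n • F) F).toNat : ℚ)) ∈ eventuallyPoly := by
  set I := Ideal.span (Set.range a) with hI
  let op : ∀ (s : ι ⊕ Unit) (g : ℕ × ℕ), ↥(I ^ g.1 • F) →ₗ[R] ↥(I ^ (sh2 ι Unit s g).1 • F) :=
    fun s g => match s with
      | .inl i => powOp a F i g.1
      | .inr _ => LinearMap.id
  have hfg : FG op := by
    refine FG.of_surjective (FG.tensor (fg_powOp a hF) fg_idOp)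
      (fun g => (TensorProduct.rid R ↥(I ^ g.1 • F)).toLinearMap)
      (fun g => (TensorProduct.rid R _).surjective) ?_
    rintro (i | i) ⟨m, n⟩ x
    · induction x using TensorProduct.induction_on with
      | zero => simp
      | add x y hx hy => rw [map_add, map_add, hx, hy, map_add, map_add]
      | tmul x r =>
        change TensorProduct.rid R _ (powOp a F i m x ⊗ₜ[R] r) =
          powOp a F i m (TensorProduct.rid R _ (x ⊗ₜ[R] r))
        rw [TensorProduct.rid_tmul, TensorProduct.rid_tmul, map_smul]
    · induction x using TensorProduct.induction_on with
      | zero => simp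
      | add x y hx hy => rw [map_add, map_add, hx, hy, map_add, map_add]
      | tmul x r => rfl
  have hc : OpComm op := by
    rintro (i | i) (j | j) ⟨m, n⟩ x
    · exact congrArg (DirectSum.lof R (ℕ × ℕ) (fun g => ↥(I ^ g.1 • F)) (m + 1 + 1, n))
        (powOp_comm a F i j m x)
    all_goals rfl
  have hle : ∀ n, I ^ (n + 1) • F ≤ I ^ n • F := fun n =>
    Submodule.smul_mono_left (Ideal.pow_le_pow_right n.le_succ)
  have hleF : ∀ n, I ^ n • F ≤ F := fun n => Submodule.smul_le_right
  have key : ∀ g : ℕ × ℕ, relLen ((I ^ (g.1 + 1) • F).comap (I ^ g.1 • F).subtype) ⊤ =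
      relLen (I ^ (g.1 + 1) • F) (I ^ g.1 • F) := by
    intro g
    have := relLen_comap (I ^ g.1 • F).subtype ⊤ (I ^ (g.1 + 1) • F)
    rw [top_inf_eq, Submodule.map_top, Submodule.range_subtype, sup_eq_right.2 (hle g.1)] at this
    exact this
  have hlen : ∀ n, relLen (I ^ (n + 1) • F) (I ^ n • F) ≠ ⊤ := fun n h => by
    apply hfin (n + 1)
    rw [← top_le_iff, ← h]
    exact relLen_mono le_rfl (hle n) (hleF n)
  have h := (hfg.noe hc).relLen_mem_biPoly hc
    (A := fun g => (I ^ (g.1 + 1) • F).comap (I ^ g.1 • F).subtype) (B := fun _ => ⊤) (by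
      rintro (i | i) ⟨m, n⟩ x hx
      · exact (powOp a F i (m + 1) ⟨x.1, hx⟩).2
      · exact hx) (fun _ _ _ _ => trivial) (fun _ => le_top)
    (fun g => by rw [key]; exact hlen g.1)
  simp only [key] at h
  convert eventuallyPoly_sum (biPoly_row h 0) using 2 with n
  induction n with
  | zero => simp [Ideal.one_eq_top, relLen_self]
  | succ n ih =>
    rw [Finset.sum_range_succ, ← ih, relLen_add (hle n) (hleF n),
      ENat.toNat_add (hlen n) (hfin n)]
    push_cast
    ring

theorem relLen_top_mem_eventuallyPoly [IsNoetherianRing R] [Module.Finite R K] {J : Ideal R}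
    (H : ℕ → Submodule R K) (k : ℕ) (hH : ∀ n ≥ k, H (n + 1) = J • H n)
    (hfin : ∀ n, relLen (H n) ⊤ ≠ ⊤) :
    (fun n => ((relLen (H n) ⊤).toNat : ℚ)) ∈ eventuallyPoly := by
  obtain ⟨S, rfl⟩ := IsNoetherian.noetherian J
  have hS : Ideal.span (Set.range ((↑) : S → R)) = Submodule.span R (S : Set R) := by
    rw [Subtype.range_coe]
  have hpow : ∀ n, H (n + k) = Ideal.span (Set.range ((↑) : S → R)) ^ n • H k := by
    intro n
    induction n with
    | zero => simp [Ideal.one_eq_top]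
    | succ n ih =>
      rw [pow_succ', ← smul_eq_mul, Submodule.smul_assoc, ← ih, hS, ← hH _ (by omega)]
      congr 1
      omega
  have hle : ∀ n, Ideal.span (Set.range ((↑) : S → R)) ^ n • H k ≤ H k :=
    fun n => Submodule.smul_le_right
  have hfin' : ∀ n, relLen (Ideal.span (Set.range ((↑) : S → R)) ^ n • H k) (H k) ≠ ⊤ :=
    fun n h => by
      apply hfin (n + k)
      rw [← top_le_iff, ← h, hpow]
      exact relLen_mono le_rfl (hle n) le_top
  have h := relLen_pow_smul_mem_eventuallyPoly ((↑) : S → R) (IsNoetherian.noetherian (H k)) hfin'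
  refine eventuallyPoly_of_add_nat k ?_
  convert Submodule.add_mem _ h (eventuallyPoly_const ((relLen (H k) ⊤).toNat : ℚ)) using 2 with n
  rw [hpow, relLen_add (hle n) le_top, ENat.toNat_add (hfin' n) (hfin k)]
  push_cast
  rfl

end HilbertSamuel

theorem span_range_smul_le {R : Type} [CommRing R] {ι : Type} {K : Type} [AddCommGroup K]
    [Module R K] {a : ι → R} {F F' : Submodule R K} (h : ∀ i, ∀ x ∈ F, a i • x ∈ F') :
    Ideal.span (Set.range a) • F ≤ F' := by
  rw [Submodule.smul_le]
  intro r hr x hx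
  induction hr using Submodule.span_induction with
  | mem r hr =>
    obtain ⟨i, rfl⟩ := hr
    exact h i x hx
  | zero => rw [zero_smul]; exact Submodule.zero_mem _
  | add r r' _ _ h h' => rw [add_smul]; exact Submodule.add_mem _ h h'
  | smul c r _ h => rw [smul_assoc]; exact Submodule.smul_mem _ c h

namespace Tower

variable {R : Type} [CommRing R] {ι : Type} {a : ι → R}
  {T : ℕ × ℕ → Type} [∀ g, AddCommGroup (T g)] [∀ g, Module R (T g)] (τ : Tower a T)

/-- The image of the transition map to bidegree zero. -/
def image (m n : ℕ) : Submodule R (T (0, 0)) := LinearMap.range (τ.q 0 n ∘ₗ τ.p m n)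

theorem image_zero_right (m : ℕ) : τ.image m 0 = LinearMap.range (τ.p m 0) := by
  have : τ.q 0 0 = LinearMap.id := LinearMap.ext (τ.q_zero 0)
  rw [image, this, LinearMap.id_comp]

theorem image_zero_left (n : ℕ) : τ.image 0 n = LinearMap.range (τ.q 0 n) := by
  have : τ.p 0 n = LinearMap.id := LinearMap.ext (τ.p_zero n)
  rw [image, this, LinearMap.comp_id]

theorem image_zero : τ.image 0 0 = ⊤ := by
  have : τ.q 0 0 = LinearMap.id := LinearMap.ext (τ.q_zero 0)
  rw [image_zero_left, this, LinearMap.range_id]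

theorem image_swap (m n : ℕ) : τ.swap.image m n = τ.image n m := by
  have : τ.q 0 m ∘ₗ τ.p n m = τ.p n 0 ∘ₗ τ.q n m := LinearMap.ext (τ.q_p n m)
  rw [image, image, this]
  rfl

theorem smul_image_le_left (m n : ℕ) :
    Ideal.span (Set.range a) • τ.image m n ≤ τ.image (m + 1) n := by
  apply span_range_smul_le
  rintro i _ ⟨x, rfl⟩
  exact ⟨τ.op (.inl i) (m, n) x,
    (congrArg (τ.q 0 n) (τ.p_inl i m n x)).trans (map_smul _ _ _)⟩

theorem smul_image_le_right (m n : ℕ) :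
    Ideal.span (Set.range a) • τ.image m n ≤ τ.image m (n + 1) := by
  rw [← τ.image_swap n m, ← τ.image_swap (n + 1) m]
  exact τ.swap.smul_image_le_left n m

theorem exists_image_le_left :
    ∃ k, ∀ m ≥ k, ∀ n, τ.image (m + 1) n ≤ Ideal.span (Set.range a) • τ.image m n := by
  obtain ⟨k, hk⟩ := τ.noe.exists_generated τ.mixed (S := fun _ => ⊤) fun _ _ _ _ => trivial
  refine ⟨k, fun m hm n => ?_⟩
  have : (⨆ i, (⊤ : Submodule R (T (m, n))).map (τ.op (.inl i) (m, n))) ≤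
      (Ideal.span (Set.range a) • τ.image m n).comap (τ.q 0 n ∘ₗ τ.p (m + 1) n) := by
    refine iSup_le fun i => ?_
    rintro _ ⟨x, -, rfl⟩
    have h : τ.q 0 n (τ.p (m + 1) n (τ.op (.inl i) (m, n) x)) =
        a i • τ.q 0 n (τ.p m n x) :=
      (congrArg (τ.q 0 n) (τ.p_inl i m n x)).trans (map_smul _ _ _)
    rw [Submodule.mem_comap, LinearMap.comp_apply, h]
    exact Submodule.smul_mem_smul (Ideal.subset_span ⟨i, rfl⟩) ⟨x, rfl⟩
  rintro _ ⟨x, rfl⟩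
  exact this (hk m hm n trivial)

theorem exists_image_succ : ∃ k,
    (∀ m ≥ k, ∀ n, τ.image (m + 1) n = Ideal.span (Set.range a) • τ.image m n) ∧
    ∀ n ≥ k, ∀ m, τ.image m (n + 1) = Ideal.span (Set.range a) • τ.image m n := by
  obtain ⟨k, hk⟩ := τ.exists_image_le_left
  obtain ⟨l, hl⟩ := τ.swap.exists_image_le_left
  refine ⟨max k l, fun m hm n => le_antisymm (hk m (by omega) n) (τ.smul_image_le_left m n),
    fun n hn m => le_antisymm ?_ (τ.smul_image_le_right m n)⟩
  rw [← τ.image_swap n m, ← τ.image_swap (n + 1) m]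
  exact hl n (by omega) m

theorem pow_smul_le_image (m n : ℕ) :
    Ideal.span (Set.range a) ^ (m + n) • (⊤ : Submodule R (T (0, 0))) ≤ τ.image m n := by
  induction n with
  | zero =>
    induction m with
    | zero => rw [image_zero]; exact le_top
    | succ m ih =>
      rw [show m + 1 + 0 = m + 0 + 1 by omega, pow_succ', ← smul_eq_mul, Submodule.smul_assoc]
      exact (Submodule.smul_mono le_rfl ih).trans (τ.smul_image_le_left m 0)
  | succ n ih =>
    rw [show m + (n + 1) = m + n + 1 by omega, pow_succ', ← smul_eq_mul, Submodule.smul_assoc]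
    exact (Submodule.smul_mono le_rfl ih).trans (τ.smul_image_le_right m n)

theorem image_self_le_left (m n : ℕ) : τ.image m n ≤ τ.image m 0 := by
  rintro _ ⟨x, rfl⟩
  rw [image_zero_right]
  exact ⟨τ.q m n x, (τ.q_p m n x).symm⟩

theorem image_self_le_right (m n : ℕ) : τ.image m n ≤ τ.image 0 n := by
  rintro _ ⟨x, rfl⟩
  rw [image_zero_left]
  exact ⟨τ.p m n x, rfl⟩

section Image

variable (hK : ∀ n, relLen (Ideal.span (Set.range a) ^ n • (⊤ : Submodule R (T (0, 0)))) ⊤ ≠ ⊤)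
include hK

theorem relLen_image_ne_top {F : Submodule R (T (0, 0))} (m n : ℕ) (hF : τ.image m n ≤ F) :
    relLen F ⊤ ≠ ⊤ := fun h => by
  apply hK (m + n)
  rw [← top_le_iff, ← h]
  exact relLen_mono ((τ.pow_smul_le_image m n).trans hF) le_top le_rfl

variable [IsNoetherianRing R] [Module.Finite R (T (0, 0))]

theorem relLen_image_sup_mem_eventuallyPoly :
    (fun n => ((relLen (τ.image n 0 ⊔ τ.image 0 n) ⊤).toNat : ℚ)) ∈ eventuallyPoly := by
  obtain ⟨k, hk, hk'⟩ := τ.exists_image_succ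
  refine relLen_top_mem_eventuallyPoly (J := Ideal.span (Set.range a)) _ k
    (fun n hn => by rw [hk n hn, hk' n hn, Submodule.smul_sup])
    (fun n => τ.relLen_image_ne_top hK n 0 le_sup_left)

theorem relLen_image_inf_mem_eventuallyPoly :
    (fun n => ((relLen (τ.image n n) (τ.image n 0 ⊓ τ.image 0 n)).toNat : ℚ)) ∈
      eventuallyPoly := by
  obtain ⟨k, hk, hk'⟩ := τ.exists_image_succ
  have h1 := relLen_top_mem_eventuallyPoly (J := Ideal.span (Set.range a))
    (fun n => τ.image n 0) k (fun n hn => hk n hn 0)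
    (fun n => τ.relLen_image_ne_top hK n 0 le_rfl)
  have h2 := relLen_top_mem_eventuallyPoly (J := Ideal.span (Set.range a))
    (fun n => τ.image 0 n) k (fun n hn => hk' n hn 0)
    (fun n => τ.relLen_image_ne_top hK 0 n le_rfl)
  have h3 := relLen_top_mem_eventuallyPoly
    (J := Ideal.span (Set.range a) * Ideal.span (Set.range a))
    (fun n => τ.image n n) k
    (fun n hn => by rw [hk n hn, hk' n hn, ← smul_eq_mul, Submodule.smul_assoc])
    (fun n => τ.relLen_image_ne_top hK n n le_rfl)
  have h4 := τ.relLen_image_sup_mem_eventuallyPoly hK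
  convert Submodule.add_mem _ (Submodule.sub_mem _ (Submodule.sub_mem _ h3 h1) h2) h4 using 2
    with n
  have e1 : relLen (τ.image n n) ⊤ = relLen (τ.image n n) (τ.image n 0 ⊓ τ.image 0 n) +
      (relLen (τ.image 0 n) (τ.image 0 n ⊔ τ.image n 0) + relLen (τ.image n 0) ⊤) := by
    have := relLen_comap LinearMap.id (τ.image n 0) (τ.image 0 n)
    rw [Submodule.map_id, Submodule.comap_id] at this
    rw [← this, ← relLen_add inf_le_left le_top,
      ← relLen_add (le_inf (τ.image_self_le_left n n) (τ.image_self_le_right n n)) le_top]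
  have e2 : relLen (τ.image 0 n) ⊤ = relLen (τ.image 0 n) (τ.image 0 n ⊔ τ.image n 0) +
      relLen (τ.image n 0 ⊔ τ.image 0 n) ⊤ := by
    rw [sup_comm (τ.image n 0), ← relLen_add le_sup_left le_top]
  have f1 := τ.relLen_image_ne_top hK n n le_rfl
  have f2 := τ.relLen_image_ne_top hK 0 n le_rfl
  rw [e1] at f1
  rw [e2] at f2
  obtain ⟨f3, f4⟩ := WithTop.add_ne_top.1 f1
  obtain ⟨f5, f6⟩ := WithTop.add_ne_top.1 f4
  obtain ⟨-, f7⟩ := WithTop.add_ne_top.1 f2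
  simp only [Pi.add_apply, Pi.sub_apply]
  rw [e1, e2, ENat.toNat_add f3 f4, ENat.toNat_add f5 f6, ENat.toNat_add f5 f7]
  push_cast
  ring

end Image

theorem relLen_map_q_kerP_mem_eventuallyPoly [Finite ι]
    (hfin : ∀ m n, Module.length R (LinearMap.ker (τ.p m n)) ≠ ⊤) :
    (fun n => ((relLen ((LinearMap.ker (τ.p n n)).map (τ.q n n))
      (LinearMap.ker (τ.p n 0))).toNat : ℚ)) ∈ eventuallyPoly :=
  τ.relLen_map_q_mem_eventuallyPoly (S := τ.kerP) τ.stable_kerP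
    (fun m n x hx => (τ.p_t m n x).trans ((congrArg (τ.t 0 n) hx).trans (map_zero _)))
    (fun m => hfin m 0)

theorem relLen_map_p_kerQP_mem_eventuallyPoly [Finite ι]
    (hfin : ∀ m n, Module.length R (LinearMap.ker (τ.q m n)) ≠ ⊤) :
    (fun n => ((relLen ((LinearMap.ker (τ.q 0 n ∘ₗ τ.p n n)).map (τ.p n n))
      (LinearMap.ker (τ.q 0 n))).toNat : ℚ)) ∈ eventuallyPoly := by
  have h0 : ∀ n, τ.kerQP (0, n) = LinearMap.ker (τ.q 0 n) := fun n => by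
    have : τ.p 0 n = LinearMap.id := LinearMap.ext (τ.p_zero n)
    change LinearMap.ker (τ.q 0 n ∘ₗ τ.p 0 n) = _
    rw [this, LinearMap.comp_id]
  have h := τ.swap.relLen_map_q_mem_eventuallyPoly (S := fun g => τ.kerQP g.swap)
    τ.stable_kerQP.swap
    (fun m n x hx => (congrArg (τ.q 0 m) (τ.p_s n m x)).trans hx)
    (fun m h => hfin 0 m ((congrArg (fun S : Submodule R (T (0, m)) => Module.length R S)
      (h0 m)).symm.trans h))
  exact eventuallyPoly_of_eq h 0 fun n _ => congrArg
    (fun S : Submodule R (T (0, n)) => ((relLen ((τ.kerQP (n, n)).map (τ.p n n)) S).toNat : ℚ))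
    (h0 n).symm

end Tower

section Diagram

variable {R : Type} [CommRing R] {T U A T' U' V K B V' K' : Type}
  [AddCommGroup T] [Module R T] [AddCommGroup U] [Module R U] [AddCommGroup A] [Module R A]
  [AddCommGroup T'] [Module R T'] [AddCommGroup U'] [Module R U'] [AddCommGroup V] [Module R V]
  [AddCommGroup K] [Module R K] [AddCommGroup B] [Module R B] [AddCommGroup V'] [Module R V']
  [AddCommGroup K'] [Module R K']
  {p : T →ₗ[R] U} {π : U →ₗ[R] A} {δ : A →ₗ[R] T'} {p' : T' →ₗ[R] U'}
  {v : V →ₗ[R] K} {ρ : K →ₗ[R] B} {ε : B →ₗ[R] V'} {v' : V' →ₗ[R] K'}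
  {q : T →ₗ[R] V} {u : U →ₗ[R] K} {φ : A →ₗ[R] B} {q' : T' →ₗ[R] V'}

theorem relLen_inf_sup (A B : Submodule R U) : relLen (B ⊓ A) B = relLen A (A ⊔ B) := by
  simpa using relLen_comap LinearMap.id B A

theorem relLen_range_eq_add (hδ : Function.Exact δ p')
    (hρ : Function.Exact v ρ) (hε : Function.Exact ρ ε) (hv' : Function.Exact ε v')
    (hφ : ∀ x, φ (π x) = ρ (u x)) (hq' : ∀ x, ε (φ x) = q' (δ x))
    (h : ∀ x, q' (δ x) = 0 → ∃ y, φ x = ρ (u y)) :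
    relLen (LinearMap.range φ) ⊤ = relLen (LinearMap.range v ⊔ LinearMap.range u) ⊤ +
      relLen ((LinearMap.ker p').map q') (LinearMap.ker v') := by
  have h1 : relLen (LinearMap.range φ) (LinearMap.range φ ⊔ LinearMap.range ρ) =
      relLen (LinearMap.range v ⊔ LinearMap.range u) ⊤ := by
    rw [← Submodule.map_top ρ, ← relLen_comap ρ ⊤ (LinearMap.range φ), top_inf_eq]
    congr 1
    ext x
    rw [Submodule.mem_comap, Submodule.mem_sup]
    constructor
    · rintro ⟨y, hy⟩
      obtain ⟨z, hz⟩ := h y (by rw [← hq', hy, hε.apply_apply_eq_zero])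
      obtain ⟨w, hw⟩ := (hρ (x - u z)).1 (by rw [map_sub, ← hz, hy, sub_self])
      exact ⟨_, ⟨w, rfl⟩, _, ⟨z, rfl⟩, by rw [hw, sub_add_cancel]⟩
    · rintro ⟨_, ⟨w, rfl⟩, _, ⟨z, rfl⟩, rfl⟩
      exact ⟨π z, by rw [hφ, map_add, hρ.apply_apply_eq_zero, zero_add]⟩
  have h2 : relLen (LinearMap.range φ ⊔ LinearMap.range ρ) ⊤ =
      relLen ((LinearMap.ker p').map q') (LinearMap.ker v') := by
    have hmap : (⊤ : Submodule R B).map ε = LinearMap.ker v' := by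
      rw [Submodule.map_top, hv'.linearMap_ker_eq]
    have hle : (LinearMap.ker p').map q' ≤ LinearMap.ker v' := by
      rintro _ ⟨x, hx, rfl⟩
      obtain ⟨y, rfl⟩ := (hδ x).1 hx
      rw [LinearMap.mem_ker, ← hq', hv'.apply_apply_eq_zero]
    have := relLen_comap ε ⊤ ((LinearMap.ker p').map q')
    rw [hmap, sup_eq_right.2 hle, top_inf_eq] at this
    rw [← this]
    congr 1
    ext x
    rw [Submodule.mem_comap, Submodule.mem_sup]
    constructor
    · rintro ⟨_, ⟨y, rfl⟩, _, ⟨z, rfl⟩, rfl⟩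
      exact ⟨δ y, hδ.apply_apply_eq_zero y, by
        rw [map_add, hε.apply_apply_eq_zero, add_zero, hq']⟩
    · rintro ⟨y, hy, hyx⟩
      obtain ⟨z, rfl⟩ := (hδ y).1 hy
      obtain ⟨w, hw⟩ := (hε (x - φ z)).1 (by rw [map_sub, hq', hyx, sub_self])
      exact ⟨_, ⟨z, rfl⟩, _, ⟨w, rfl⟩, by rw [hw, add_sub_cancel]⟩
  rw [relLen_add (le_sup_left : LinearMap.range φ ≤ LinearMap.range φ ⊔ LinearMap.range ρ) le_top,
    h1, h2]

theorem length_ker_eq_add (hπ : Function.Exact p π) (hδ' : Function.Exact π δ)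
    (hδ : Function.Exact δ p') (hρ : Function.Exact v ρ)
    (hu : ∀ x, u (p x) = v (q x))
    (hφ : ∀ x, φ (π x) = ρ (u x)) (hq' : ∀ x, ε (φ x) = q' (δ x))
    (h : ∀ x, q' (δ x) = 0 → ∃ y, φ x = ρ (u y)) :
    Module.length R (LinearMap.ker φ) =
      Module.length R ↥(LinearMap.ker p' ⊓ LinearMap.ker q') +
      (relLen ((LinearMap.ker (u ∘ₗ p)).map p) (LinearMap.ker u) +
        relLen (LinearMap.range (u ∘ₗ p)) (LinearMap.range v ⊓ LinearMap.range u)) := by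
  have h1 : (LinearMap.ker φ).map δ = LinearMap.ker p' ⊓ LinearMap.ker q' := by
    apply le_antisymm
    · rintro _ ⟨x, hx, rfl⟩
      refine ⟨hδ.apply_apply_eq_zero x, ?_⟩
      rw [SetLike.mem_coe, LinearMap.mem_ker, ← hq', LinearMap.mem_ker.1 hx, map_zero]
    · rintro w ⟨hw, hw'⟩
      obtain ⟨x, rfl⟩ := (hδ w).1 hw
      obtain ⟨y, hy⟩ := h x hw'
      exact ⟨x - π y, by rw [SetLike.mem_coe, LinearMap.mem_ker, map_sub, hφ, hy, sub_self],
        by rw [map_sub, hδ'.apply_apply_eq_zero, sub_zero]⟩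
  set C := (LinearMap.range v).comap u with hC
  have h2 : LinearMap.ker φ ⊓ LinearMap.ker δ = C.map π := by
    apply le_antisymm
    · rintro x ⟨hx, hx'⟩
      obtain ⟨y, rfl⟩ := (hδ' x).1 hx'
      exact ⟨y, (hρ (u y)).1 ((hφ y).symm.trans hx), rfl⟩
    · rintro _ ⟨y, hy, rfl⟩
      exact ⟨(hφ y).trans ((hρ (u y)).2 hy), hδ'.apply_apply_eq_zero y⟩
  have hpC : LinearMap.range p ≤ C := by
    rintro _ ⟨x, rfl⟩
    exact ⟨q x, (hu x).symm⟩
  have huC : LinearMap.ker u ≤ C := fun x hx => by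
    rw [hC, Submodule.mem_comap, LinearMap.mem_ker.1 hx]
    exact Submodule.zero_mem _
  have h3 : Module.length R (C.map π) = relLen (LinearMap.range p) C := by
    rw [← relLen_bot, ← bot_sup_eq (C.map π), ← relLen_comap π C ⊥, Submodule.comap_bot,
      hπ.linearMap_ker_eq, inf_eq_right.2 hpC]
  have h4 : relLen (LinearMap.range p) (LinearMap.range p ⊔ LinearMap.ker u) =
      relLen ((LinearMap.ker (u ∘ₗ p)).map p) (LinearMap.ker u) := by
    rw [← relLen_inf_sup]
    congr 1
    ext x
    constructor
    · rintro ⟨hx, y, rfl⟩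
      exact ⟨y, hx, rfl⟩
    · rintro ⟨y, hy, rfl⟩
      exact ⟨hy, y, rfl⟩
  have h5 : relLen (LinearMap.range p ⊔ LinearMap.ker u) C =
      relLen (LinearMap.range (u ∘ₗ p)) (LinearMap.range v ⊓ LinearMap.range u) := by
    have hCu : C.map u = LinearMap.range v ⊓ LinearMap.range u := by
      rw [hC, Submodule.map_comap_eq, inf_comm]
    have hle : LinearMap.range (u ∘ₗ p) ≤ LinearMap.range v ⊓ LinearMap.range u := by
      rintro _ ⟨x, rfl⟩
      exact ⟨⟨q x, (hu x).symm⟩, p x, rfl⟩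
    have := relLen_comap u C (LinearMap.range (u ∘ₗ p))
    rw [hCu, sup_eq_right.2 hle] at this
    rw [← this, LinearMap.range_comp, Submodule.comap_map_eq, inf_eq_right.2 (sup_le hpC huC)]
  rw [length_eq_inf_ker_add_map δ, h1, h2, h3,
    relLen_add (le_sup_left : LinearMap.range p ≤ LinearMap.range p ⊔ LinearMap.ker u)
      (sup_le hpC huC), h4, h5, add_comm]

end Diagram

section TowerSeq

variable {R : Type} [CommRing R] {ι : Type} {a : ι → R}
  {T : ℕ × ℕ → Type} [∀ g, AddCommGroup (T g)] [∀ g, Module R (T g)]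
  {T' : ℕ × ℕ → Type} [∀ g, AddCommGroup (T' g)] [∀ g, Module R (T' g)]
  {A : ℕ × ℕ → Type} [∀ g, AddCommGroup (A g)] [∀ g, Module R (A g)]

variable (A) in
/-- Exact sequences linking two towers, of the shape of long exact sequences for Tor. -/
structure TowerSeq (τ : Tower a T) (τ' : Tower a T') where
  /-- the map from the first tower -/
  π : ∀ m n, T (0, n) →ₗ[R] A (m, n)
  /-- the connecting map -/
  δ : ∀ m n, A (m, n) →ₗ[R] T' (m, n)
  /-- the transition map to degree zero in the second variable -/
  φ : ∀ m n, A (m, n) →ₗ[R] A (m, 0)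
  /-- the operators increasing the first degree -/
  α : ∀ (_ : ι) (m n), A (m, n) →ₗ[R] A (m + 1, n)
  /-- the operators increasing the second degree -/
  β : ∀ (_ : ι) (m n), A (m, n) →ₗ[R] A (m, n + 1)
  exact_π : ∀ m n, Function.Exact (τ.p m n) (π m n)
  exact_δ : ∀ m n, Function.Exact (π m n) (δ m n)
  exact_p : ∀ m n, Function.Exact (δ m n) (τ'.p m n)
  φ_π : ∀ m n x, φ m n (π m n x) = π m 0 (τ.q 0 n x)
  δ_φ : ∀ m n x, δ m 0 (φ m n x) = τ'.q m n (δ m n x)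
  δ_α : ∀ i m n x, δ (m + 1) n (α i m n x) = τ'.op (.inl i) (m, n) (δ m n x)
  δ_β : ∀ i m n x, δ m (n + 1) (β i m n x) = τ'.op (.inr i) (m, n) (δ m n x)
  φ_α : ∀ i m n x, φ (m + 1) n (α i m n x) = α i m 0 (φ m n x)
  φ_β : ∀ i m n x, φ m (n + 1) (β i m n x) = a i • φ m n x
  α_π : ∀ i m n x, α i m n (π m n x) = a i • π (m + 1) n x

namespace TowerSeq

variable {τ : Tower a T} {τ' : Tower a T'} (σ : TowerSeq A τ τ')

/-- The submodule controlling the composite connecting map. -/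
def target (m n e : ℕ) : Submodule R (A (m, 0)) :=
  (Ideal.span (Set.range a) ^ e • (⊤ : Submodule R (T (0, 0))) ⊔ τ.image 0 n).map (σ.π m 0)

/-- The composite connecting map lands in the given submodule. -/
def Lands (m n e : ℕ) : Prop :=
  ∀ x, τ'.q m n (σ.δ m n x) = 0 → σ.φ m n x ∈ σ.target m n e

theorem lands_of_le {m n e : ℕ}
    (h : τ'.kerP (m, n) ⊓ τ'.kerQ (m, n) ≤ ((σ.target m n e).comap (σ.φ m n)).map (σ.δ m n)) :
    σ.Lands m n e := by
  intro x hx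
  obtain ⟨y, hy, hyx⟩ := h ⟨(σ.exact_p m n).apply_apply_eq_zero x, hx⟩
  obtain ⟨z, hz⟩ := (σ.exact_δ m n (x - y)).1 (by rw [map_sub, hyx, sub_self])
  rw [← sub_add_cancel x y, map_add]
  refine Submodule.add_mem _ ?_ hy
  rw [← hz, σ.φ_π]
  refine ⟨_, Submodule.mem_sup_right ?_, rfl⟩
  rw [τ.image_zero_left]
  exact ⟨z, rfl⟩

theorem lands_zero (m n : ℕ) : σ.Lands m n 0 := by
  intro x hx
  obtain ⟨y, hy⟩ := (σ.exact_δ m 0 (σ.φ m n x)).1 ((σ.δ_φ m n x).trans hx)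
  refine ⟨y, Submodule.mem_sup_left ?_, hy⟩
  rw [pow_zero, Ideal.one_eq_top, Submodule.top_smul]
  trivial

theorem smul_pow_mem {i : ι} {e : ℕ} {x : T (0, 0)}
    (hx : x ∈ Ideal.span (Set.range a) ^ e • (⊤ : Submodule R (T (0, 0)))) :
    a i • x ∈ Ideal.span (Set.range a) ^ (e + 1) • (⊤ : Submodule R (T (0, 0))) := by
  rw [pow_succ', ← smul_eq_mul, Submodule.smul_assoc]
  exact Submodule.smul_mem_smul (Ideal.subset_span ⟨i, rfl⟩) hx

theorem exists_lands_succ : ∃ k,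
    (∀ m ≥ k, ∀ n e, σ.Lands m n e → σ.Lands (m + 1) n (e + 1)) ∧
    (∀ n ≥ k, ∀ m e, σ.Lands m n e → σ.Lands m (n + 1) (e + 1)) := by
  have hS : Stable τ'.op (fun g => τ'.kerP g ⊓ τ'.kerQ g) := fun s g x hx =>
    ⟨τ'.stable_kerP s g x hx.1, τ'.stable_kerQ s g x hx.2⟩
  obtain ⟨k, hk⟩ := τ'.noe.exists_generated τ'.mixed hS
  obtain ⟨l, hl⟩ := τ'.noe.exists_generated' τ'.mixed hS
  refine ⟨max k l, fun m hm n e h => σ.lands_of_le ?_, fun n hn m e h => σ.lands_of_le ?_⟩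
  · refine (hk m (by omega) n).trans (iSup_le fun i => ?_)
    rintro _ ⟨w, ⟨hw, hw'⟩, rfl⟩
    obtain ⟨x, rfl⟩ := (σ.exact_p m n w).1 hw
    refine ⟨σ.α i m n x, ?_, σ.δ_α i m n x⟩
    obtain ⟨y, hy, hyx⟩ := h x hw'
    rw [SetLike.mem_coe, Submodule.mem_comap, σ.φ_α, ← hyx, σ.α_π, ← map_smul]
    refine ⟨_, ?_, rfl⟩
    obtain ⟨y₁, hy₁, y₂, hy₂, rfl⟩ := Submodule.mem_sup.1 hy
    rw [smul_add]
    exact Submodule.add_mem_sup (smul_pow_mem hy₁) (Submodule.smul_mem _ _ hy₂)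
  · refine (hl n (by omega) m).trans (iSup_le fun i => ?_)
    rintro _ ⟨w, ⟨hw, hw'⟩, rfl⟩
    obtain ⟨x, rfl⟩ := (σ.exact_p m n w).1 hw
    refine ⟨σ.β i m n x, ?_, σ.δ_β i m n x⟩
    obtain ⟨y, hy, hyx⟩ := h x hw'
    rw [SetLike.mem_coe, Submodule.mem_comap, σ.φ_β, ← hyx, ← map_smul]
    refine ⟨_, ?_, rfl⟩
    obtain ⟨y₁, hy₁, y₂, hy₂, rfl⟩ := Submodule.mem_sup.1 hy
    rw [smul_add]
    exact Submodule.add_mem_sup (smul_pow_mem hy₁) (τ.smul_image_le_right 0 n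
      (Submodule.smul_mem_smul (Ideal.subset_span ⟨i, rfl⟩) hy₂))

theorem exists_forall_eq : ∃ k, ∀ n ≥ k, ∀ x, τ'.q n n (σ.δ n n x) = 0 →
    ∃ y, σ.φ n n x = σ.π n 0 (τ.q 0 n y) := by
  obtain ⟨k, hk, hk'⟩ := σ.exists_lands_succ
  have h : ∀ d, σ.Lands (k + d) (k + d) (2 * d) := by
    intro d
    induction d with
    | zero => exact σ.lands_zero _ _
    | succ d ih => exact hk' (k + d) (by omega) _ _ (hk (k + d) (by omega) _ _ ih)
  refine ⟨2 * k, fun n hn x hx => ?_⟩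
  obtain ⟨d, rfl⟩ : ∃ d, n = k + d := ⟨n - k, by omega⟩
  obtain ⟨y, hy, hyx⟩ := h d x hx
  obtain ⟨y₁, hy₁, y₂, hy₂, rfl⟩ := Submodule.mem_sup.1 hy
  rw [τ.image_zero_left] at hy₂
  obtain ⟨z, rfl⟩ := hy₂
  have hy₃ : y₁ ∈ τ.image (k + d) 0 := τ.pow_smul_le_image (k + d) 0
    (Submodule.smul_mono_left (Ideal.pow_le_pow_right (by omega)) hy₁)
  rw [τ.image_zero_right] at hy₃
  obtain ⟨w, rfl⟩ := hy₃
  exact ⟨z, by rw [← hyx, map_add, (σ.exact_π (k + d) 0).apply_apply_eq_zero, zero_add]⟩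

variable [IsNoetherianRing R] [Finite ι] [Module.Finite R (T (0, 0))]
  (hK : ∀ n, relLen (Ideal.span (Set.range a) ^ n • (⊤ : Submodule R (T (0, 0)))) ⊤ ≠ ⊤)

include hK in
theorem relLen_range_mem_eventuallyPoly
    (hp : ∀ m n, Module.length R (LinearMap.ker (τ'.p m n)) ≠ ⊤) :
    (fun n => ((relLen (LinearMap.range (σ.φ n n)) ⊤).toNat : ℚ)) ∈ eventuallyPoly := by
  obtain ⟨k, hk⟩ := σ.exists_forall_eq
  refine eventuallyPoly_of_eq (Submodule.add_mem _ (τ.relLen_image_sup_mem_eventuallyPoly hK)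
    (τ'.relLen_map_q_kerP_mem_eventuallyPoly hp)) k fun n hn => ?_
  rw [relLen_range_eq_add (σ.exact_p n n) (σ.exact_π n 0) (σ.exact_δ n 0) (σ.exact_p n 0)
    (σ.φ_π n n) (σ.δ_φ n n) (hk n hn), ENat.toNat_add, Nat.cast_add, ← τ.image_zero_left,
    ← τ.image_zero_right, Pi.add_apply]
  · rw [← τ.image_zero_right]
    exact τ.relLen_image_ne_top hK n 0 le_sup_left
  · intro h
    apply hp n 0
    rw [← top_le_iff, ← h, ← relLen_bot]
    refine relLen_mono bot_le ?_ le_rfl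
    rintro _ ⟨x, hx, rfl⟩
    obtain ⟨y, rfl⟩ := (σ.exact_p n n x).1 hx
    rw [← σ.δ_φ]
    exact (σ.exact_p n 0).apply_apply_eq_zero _

include hK in
theorem length_ker_mem_eventuallyPoly
    (hp : ∀ m n, Module.length R (LinearMap.ker (τ'.p m n)) ≠ ⊤)
    (hq : ∀ m n, Module.length R (LinearMap.ker (τ.q m n)) ≠ ⊤) :
    (fun n => ((Module.length R (LinearMap.ker (σ.φ n n))).toNat : ℚ)) ∈ eventuallyPoly := by
  obtain ⟨k, hk⟩ := σ.exists_forall_eq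
  have hpq : ∀ m n, Module.length R ↥(τ'.kerP (m, n) ⊓ τ'.kerQ (m, n)) ≠ ⊤ := fun m n h => by
    apply hp m n
    rw [← top_le_iff, ← h]
    exact Module.length_le_of_injective (Submodule.inclusion inf_le_left)
      (Submodule.inclusion_injective _)
  refine eventuallyPoly_of_eq (Submodule.add_mem _ (τ'.length_inf_mem_eventuallyPoly hpq)
    (Submodule.add_mem _ (τ.relLen_map_p_kerQP_mem_eventuallyPoly hq)
      (τ.relLen_image_inf_mem_eventuallyPoly hK))) k fun n hn => ?_
  have h1 : relLen ((LinearMap.ker (τ.q 0 n ∘ₗ τ.p n n)).map (τ.p n n))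
      (LinearMap.ker (τ.q 0 n)) ≠ ⊤ := fun h => by
    apply hq 0 n
    rw [← top_le_iff, ← h, ← relLen_bot]
    refine relLen_mono bot_le ?_ le_rfl
    rintro _ ⟨x, hx, rfl⟩
    exact hx
  have h2 : relLen (τ.image n n) (τ.image n 0 ⊓ τ.image 0 n) ≠ ⊤ := fun h => by
    apply τ.relLen_image_ne_top hK n n le_rfl
    rw [← top_le_iff, ← h]
    exact relLen_mono le_rfl
      (le_inf (τ.image_self_le_left n n) (τ.image_self_le_right n n)) le_top
  rw [length_ker_eq_add (σ.exact_π n n) (σ.exact_δ n n) (σ.exact_p n n) (σ.exact_π n 0)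
    (τ.q_p n n) (σ.φ_π n n) (σ.δ_φ n n) (hk n hn), ← τ.image_zero_left, ← τ.image_zero_right]
  refine (congrArg Nat.cast (ENat.toNat_add (hpq n n) (WithTop.add_ne_top.2 ⟨h1, h2⟩))).trans ?_
  refine (congrArg Nat.cast (congrArg _ (ENat.toNat_add h1 h2))).trans ?_
  push_cast
  rfl

end TowerSeq

end TowerSeq

section FiniteLength

theorem length_ne_top_of_maximalIdeal_le_radical {R : Type} [CommRing R] [IsNoetherianRing R]
    [IsLocalRing R] {X : Type} [AddCommGroup X] [Module R X] [Module.Finite R X] (J : Ideal R)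
    (hJ : ∀ r ∈ J, ∀ x : X, r • x = 0) (h : maximalIdeal R ≤ J.radical) :
    Module.length R X ≠ ⊤ := by
  have h0 : Ring.KrullDimLE 0 (R ⧸ J) := by
    rw [Ring.krullDimLE_zero_iff]
    intro Q hQ
    have hle : J ≤ Q.comap (Ideal.Quotient.mk J) := by
      intro r hr
      rw [Ideal.mem_comap, Ideal.Quotient.eq_zero_iff_mem.2 hr]
      exact Q.zero_mem
    have hp : (Q.comap (Ideal.Quotient.mk J)).IsPrime := hQ.comap _
    have hm : maximalIdeal R = Q.comap (Ideal.Quotient.mk J) :=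
      (maximalIdeal.isMaximal R).eq_of_le hp.ne_top (h.trans (hp.radical_le_iff.2 hle))
    have hmax : (Q.comap (Ideal.Quotient.mk J)).IsMaximal := hm ▸ maximalIdeal.isMaximal R
    have hmap := Ideal.map_comap_of_surjective (Ideal.Quotient.mk J) Ideal.Quotient.mk_surjective Q
    rcases Ideal.map_eq_top_or_isMaximal_of_surjective (Ideal.Quotient.mk J)
      Ideal.Quotient.mk_surjective hmax with h | h
    · exact absurd (hmap.symm.trans h) hQ.ne_top
    · rwa [hmap] at h
  have hart : IsArtinianRing (R ⧸ J) := IsNoetherianRing.isArtinianRing_of_krullDimLE_zero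
  have htors : Module.IsTorsionBySet R X (J : Set R) := fun x r => hJ r r.2 x
  let inst : Module (R ⧸ J) X := htors.module
  have ht : IsScalarTower R (R ⧸ J) X := htors.isScalarTower
  have hfin : Module.Finite (R ⧸ J) X := Module.Finite.of_restrictScalars_finite R _ _
  let e : X →ₛₗ[Ideal.Quotient.mk J] X := ⟨.id _, fun r x => rfl⟩
  have hX : IsArtinian R X :=
    (e.isArtinian_iff_of_bijective Function.bijective_id).2 inferInstance
  exact Module.length_ne_top

end FiniteLength

section TorRight

variable {R : Type} [CommRing R] {Y Y' : Type} [AddCommGroup Y] [Module R Y]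
  [AddCommGroup Y'] [Module R Y']

theorem torMap_smul_id_right (r : R) (k : ℕ) : ∀ (X : Type) [AddCommGroup X] [Module R X]
    (z : torM R k X Y),
    torMap k (LinearMap.id : X →ₗ[R] X) (r • (LinearMap.id : Y →ₗ[R] Y)) z = r • z := by
  match k with
  | 0 => intro X _ _ z; exact Subsingleton.elim _ _
  | 1 =>
    intro X _ _ z
    apply (torMOne X Y).injective
    rw [map_smul, torMOne_naturality]
    generalize torMOne X Y z = t
    induction t with
    | zero => rw [map_zero, smul_zero]
    | tmul x y => rw [TensorProduct.map_tmul, ← TensorProduct.tmul_smul]; rfl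
    | add a b ha hb => rw [map_add, ha, hb, smul_add]
  | k + 2 =>
    intro X _ _ z
    apply conn_injective (Y := Y) (SES.ofSurjective _ (freeCounit_surjective (R := R) X)) k
    rw [map_smul, conn_torMap_right]
    exact torMap_smul_id_right r (k + 1) _ _

theorem torMap_smul_right (k : ℕ) {X : Type} [AddCommGroup X] [Module R X] (r : R)
    (g : Y →ₗ[R] Y') (z : torM R k X Y) :
    torMap k (LinearMap.id : X →ₗ[R] X) (r • g) z =
      r • torMap k (LinearMap.id : X →ₗ[R] X) g z := by
  rw [← torMap_smul_id_right, torMap_torMap]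
  rfl

end TorRight

section Filtration

variable {R : Type} [CommRing R] {ι : Type} (a : ι → R) (M : Type) [AddCommGroup M] [Module R M]

/-- The terms of the filtration of a module by the powers of the ideal spanned by `a`. -/
abbrev Fil (m : ℕ) : Type := ↥(Ideal.span (Set.range a) ^ m • (⊤ : Submodule R M))

/-- The quotients by the terms of the filtration. -/
abbrev FilQuot (m : ℕ) : Type := M ⧸ (Ideal.span (Set.range a) ^ m • (⊤ : Submodule R M))

/-- The inclusion of a term of the filtration in the whole module. -/
def filTo (m : ℕ) : Fil a M m →ₗ[R] Fil a M 0 :=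
  Submodule.inclusion (Submodule.smul_mono (Ideal.pow_le_pow_right (Nat.zero_le m)) le_rfl)

/-- The inclusion of a term of the filtration in the preceding one. -/
def filSucc (m : ℕ) : Fil a M (m + 1) →ₗ[R] Fil a M m :=
  Submodule.inclusion (Submodule.smul_mono (Ideal.pow_le_pow_right (Nat.le_succ m)) le_rfl)

/-- Multiplication by an element of a power of the ideal. -/
def filMul {m : ℕ} {r : R} (hr : r ∈ Ideal.span (Set.range a) ^ m) : Fil a M 0 →ₗ[R] Fil a M m :=
  ((r • LinearMap.id : M →ₗ[R] M).restrict
    fun _ _ => Submodule.smul_mem_smul hr Submodule.mem_top)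

/-- The short exact sequence of a term of the filtration. -/
def filSES (m : ℕ) : SES R (Fil a M m) (Fil a M 0) (FilQuot a M m) where
  f := filTo a M m
  g := (Ideal.span (Set.range a) ^ m • (⊤ : Submodule R M)).mkQ ∘ₗ Submodule.subtype _
  inj := Submodule.inclusion_injective _
  surj x := by
    obtain ⟨x, rfl⟩ := Submodule.mkQ_surjective _ x
    exact ⟨⟨x, by rw [pow_zero, Ideal.one_eq_top, Submodule.top_smul]; trivial⟩, rfl⟩
  exact x := by
    refine (Submodule.Quotient.mk_eq_zero _).trans ⟨fun h => ⟨⟨x, h⟩, rfl⟩, ?_⟩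
    rintro ⟨y, rfl⟩
    exact y.2

/-- Multiplication by `a i` on the quotients by the filtration. -/
def quotOp (i : ι) (m : ℕ) : FilQuot a M m →ₗ[R] FilQuot a M (m + 1) :=
  Submodule.mapQ _ _ (a i • LinearMap.id) fun x hx => by
    change a i • x ∈ Ideal.span (Set.range a) ^ (m + 1) • (⊤ : Submodule R M)
    exact (powOp a ⊤ i m ⟨x, hx⟩).2

variable (N : Type) [AddCommGroup N] [Module R N] [IsNoetherianRing R] [Finite ι]
  [Module.Finite R M] [Module.Finite R N]

/-- The tower of the modules `Tor_k(I^m M, I^n N)`. -/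
noncomputable def torTower (k : ℕ) :
    Tower (T := fun g : ℕ × ℕ => torM R k (Fil a M g.1) (Fil a N g.2)) a where
  op := torOp k (powOp a ⊤) (powOp a ⊤)
  p m n := torMap k (filTo a M m) LinearMap.id
  q m n := torMap k LinearMap.id (filTo a N n)
  s m n := torMap k (filSucc a M m) LinearMap.id
  t m n := torMap k LinearMap.id (filSucc a N n)
  noe := noe_torOp (fg_powOp a Module.Finite.fg_top) (powOp_comm a ⊤) k
    (fg_powOp a Module.Finite.fg_top) (powOp_comm a ⊤)
  comm_inl i j m n x := by
    change torMap k (powOp a ⊤ i (m + 1)) _ (torMap k (powOp a ⊤ j m) _ x) =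
      torMap k (powOp a ⊤ j (m + 1)) _ (torMap k (powOp a ⊤ i m) _ x)
    rw [torMap_torMap, torMap_torMap]
    congr 2
    exact LinearMap.ext (powOp_comm a ⊤ i j m)
  comm_inr i j m n x := by
    change torMap k _ (powOp a ⊤ i (n + 1)) (torMap k _ (powOp a ⊤ j n) x) =
      torMap k _ (powOp a ⊤ j (n + 1)) (torMap k _ (powOp a ⊤ i n) x)
    rw [torMap_torMap, torMap_torMap]
    congr 2
    exact LinearMap.ext (powOp_comm a ⊤ i j n)
  mixed := torOp_mixedComm k _ _
  p_inl i m n x := by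
    rw [← torMap_smul_left]
    exact torMap_torMap k (filTo a M (m + 1)) (powOp a ⊤ i m) LinearMap.id LinearMap.id x
  p_inr i m n x := torMap_comm k (filTo a M m) (powOp a ⊤ i n) x
  q_inr i m n x := by
    rw [← torMap_smul_right]
    exact torMap_torMap k LinearMap.id LinearMap.id (filTo a N (n + 1)) (powOp a ⊤ i n) x
  q_inl i m n x := (torMap_comm k (powOp a ⊤ i m) (filTo a N n) x).symm
  p_zero n x := torMap_id k x
  q_zero m x := torMap_id k x
  q_p m n x := (torMap_comm k (filTo a M m) (filTo a N n) x).symm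
  p_s m n x := torMap_torMap k (filTo a M m) (filSucc a M m) LinearMap.id LinearMap.id x
  q_s m n x := (torMap_comm k (filSucc a M m) (filTo a N n) x).symm
  q_t m n x := torMap_torMap k LinearMap.id LinearMap.id (filTo a N n) (filSucc a N n) x
  p_t m n x := torMap_comm k (filTo a M m) (filSucc a N n) x

/-- The long exact sequences of `Tor(M / I^m M, I^n N)`. -/
noncomputable def torSeq (k : ℕ) :
    TowerSeq (fun g : ℕ × ℕ => torM R (k + 1) (FilQuot a M g.1) (Fil a N g.2))
      (torTower a M N (k + 1)) (torTower a M N k) where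
  π m n := torMap (k + 1) (filSES a M m).g LinearMap.id
  δ m n := conn (Fil a N n) (filSES a M m) k
  φ m n := torMap (k + 1) LinearMap.id (filTo a N n)
  α i m n := torMap (k + 1) (quotOp a M i m) LinearMap.id
  β i m n := torMap (k + 1) LinearMap.id (powOp a ⊤ i n)
  exact_π m n := exact_torMap_torMap _ (filSES a M m) k
  exact_δ m n := exact_torMap_conn _ (filSES a M m) k
  exact_p m n := exact_conn_torMap _ (filSES a M m) k
  φ_π m n x := (torMap_comm (k + 1) (filSES a M m).g (filTo a N n) x).symm
  δ_φ m n x := conn_torMap_right (filSES a M m) k (filTo a N n) x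
  δ_α i m n x := conn_naturality (filSES a M m) (filSES a M (m + 1)) k (powOp a ⊤ i m)
    (a i • LinearMap.id) (quotOp a M i m) LinearMap.id rfl rfl x
  δ_β i m n x := conn_torMap_right (filSES a M m) k (powOp a ⊤ i n) x
  φ_α i m n x := (torMap_comm (k + 1) (quotOp a M i m) (filTo a N n) x).symm
  φ_β i m n x := by
    rw [← torMap_smul_right]
    exact torMap_torMap (k + 1) LinearMap.id LinearMap.id (filTo a N (n + 1)) (powOp a ⊤ i n) x
  α_π i m n x := by
    rw [← torMap_smul_left]
    exact torMap_torMap (k + 1) (quotOp a M i m) (filSES a M m).g LinearMap.id LinearMap.id x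

end Filtration

section TorSMul

variable {R : Type} [CommRing R] {X X' Y Y' : Type} [AddCommGroup X] [Module R X]
  [AddCommGroup X'] [Module R X'] [AddCommGroup Y] [Module R Y] [AddCommGroup Y'] [Module R Y']

theorem smul_eq_zero_of_torMap_left (k : ℕ) {r : R} (u : X →ₗ[R] X') (v : X' →ₗ[R] X)
    (h : v ∘ₗ u = r • LinearMap.id) {x : torM R k X Y}
    (hx : torMap k u (LinearMap.id : Y →ₗ[R] Y) x = 0) : r • x = 0 := by
  have h1 := torMap_torMap k v u (LinearMap.id : Y →ₗ[R] Y) LinearMap.id x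
  rw [hx, map_zero, h, torMap_smul_left, LinearMap.comp_id, torMap_id] at h1
  exact h1.symm

theorem smul_eq_zero_of_torMap_right (k : ℕ) {r : R} (u : Y →ₗ[R] Y') (v : Y' →ₗ[R] Y)
    (h : v ∘ₗ u = r • LinearMap.id) {x : torM R k X Y}
    (hx : torMap k (LinearMap.id : X →ₗ[R] X) u x = 0) : r • x = 0 := by
  have h1 := torMap_torMap k (LinearMap.id : X →ₗ[R] X) LinearMap.id v u x
  rw [hx, map_zero, h, LinearMap.comp_id, torMap_smul_right, torMap_id] at h1
  exact h1.symm

end TorSMul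

section TorLength

set_option maxSynthPendingDepth 5

variable {R : Type} [CommRing R] {ι : Type}
  (a : ι → R) (M N : Type) [AddCommGroup M] [Module R M] [AddCommGroup N] [Module R N]

theorem smul_fil_eq_zero {r : R} (hr : r ∈ Module.annihilator R M) (m : ℕ) (x : Fil a M m) :
    r • x = 0 :=
  Subtype.ext (Module.mem_annihilator.1 hr x)

theorem smul_filQuot_eq_zero {r : R} (hr : r ∈ Module.annihilator R M) (m : ℕ)
    (x : FilQuot a M m) : r • x = 0 := by
  obtain ⟨x, rfl⟩ := Submodule.mkQ_surjective _ x
  rw [← map_smul, Module.mem_annihilator.1 hr, map_zero]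

theorem smul_filQuot_eq_zero_of_mem {m : ℕ} {r : R} (hr : r ∈ Ideal.span (Set.range a) ^ m)
    (x : FilQuot a M m) : r • x = 0 := by
  obtain ⟨x, rfl⟩ := Submodule.mkQ_surjective _ x
  rw [← map_smul]
  exact (Submodule.Quotient.mk_eq_zero _).2 (Submodule.smul_mem_smul hr Submodule.mem_top)

variable {a M N} in
theorem length_ne_top_of_smul_eq_zero [IsNoetherianRing R] [IsLocalRing R] {X : Type} [AddCommGroup X] [Module R X]
    [Module.Finite R X] (hP : maximalIdeal R ≤
      (Ideal.span (Set.range a) ⊔ Module.annihilator R M ⊔ Module.annihilator R N).radical)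
    (m : ℕ) (hI : ∀ r ∈ Ideal.span (Set.range a) ^ m, ∀ x : X, r • x = 0)
    (hM : ∀ r ∈ Module.annihilator R M, ∀ x : X, r • x = 0)
    (hN : ∀ r ∈ Module.annihilator R N, ∀ x : X, r • x = 0) : Module.length R X ≠ ⊤ := by
  refine length_ne_top_of_maximalIdeal_le_radical (Module.annihilator R X)
    (fun r hr => Module.mem_annihilator.1 hr) (hP.trans (Ideal.radical_le_radical_iff.2 ?_))
  refine sup_le (sup_le ?_ ?_) ?_
  · exact fun r hr => ⟨m, Module.mem_annihilator.2 (hI _ (Ideal.pow_mem_pow hr m))⟩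
  · exact fun r hr => Ideal.le_radical (Module.mem_annihilator.2 (hM r hr))
  · exact fun r hr => Ideal.le_radical (Module.mem_annihilator.2 (hN r hr))

variable {a M N} in
theorem relLen_pow_smul_ne_top [IsNoetherianRing R] [IsLocalRing R] {X : Type} [AddCommGroup X]
    [Module R X] [Module.Finite R X] (hP : maximalIdeal R ≤
      (Ideal.span (Set.range a) ⊔ Module.annihilator R M ⊔ Module.annihilator R N).radical)
    (m : ℕ) (hM : ∀ r ∈ Module.annihilator R M, ∀ x : X, r • x = 0)
    (hN : ∀ r ∈ Module.annihilator R N, ∀ x : X, r • x = 0) :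
    relLen (Ideal.span (Set.range a) ^ m • (⊤ : Submodule R X)) ⊤ ≠ ⊤ := by
  rw [relLen_top]
  refine length_ne_top_of_smul_eq_zero hP m (fun r hr => smul_filQuot_eq_zero_of_mem a X hr)
    (fun r hr x => ?_) (fun r hr x => ?_) <;>
    obtain ⟨x, rfl⟩ := Submodule.mkQ_surjective _ x <;> rw [← map_smul]
  · rw [hM r hr, map_zero]
  · rw [hN r hr, map_zero]

theorem length_torM_filQuot (k n : ℕ) :
    Module.length R (torM R (k + 1) (FilQuot a M n) (FilQuot a N n)) =
      relLen (LinearMap.range (torMap (k + 1) (LinearMap.id : FilQuot a M n →ₗ[R] _)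
        (filTo a N n))) ⊤ +
      Module.length R (LinearMap.ker (torMap k (LinearMap.id : FilQuot a M n →ₗ[R] _)
        (filTo a N n))) := by
  obtain ⟨d, h1, h2, h3⟩ := exists_conn_right k (filSES a N n) (FilQuot a M n)
  have e1 := h1.linearMap_ker_eq
  have e2 := h2.linearMap_ker_eq
  have e3 := h3.linearMap_ker_eq
  have h := length_eq_inf_ker_add_map d ⊤
  rw [top_inf_eq, Submodule.map_top, e2, Module.length_top, ← e3,
    ← (LinearMap.quotKerEquivRange _).length_eq, e1, ← relLen_top] at h
  exact h

variable {a M N} [IsNoetherianRing R] [IsLocalRing R] [Module.Finite R M]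
  [Module.Finite R N] (hP : maximalIdeal R ≤
  (Ideal.span (Set.range a) ⊔ Module.annihilator R M ⊔ Module.annihilator R N).radical)
include hP

theorem length_torM_filQuot_ne_top (k n : ℕ) :
    Module.length R (torM R k (FilQuot a M n) (FilQuot a N n)) ≠ ⊤ :=
  length_ne_top_of_smul_eq_zero hP n
    (fun _ hr => smul_torM_eq_zero_left k (smul_filQuot_eq_zero_of_mem a M hr))
    (fun _ hr => smul_torM_eq_zero_left k (smul_filQuot_eq_zero a M hr n))
    (fun _ hr => smul_torM_eq_zero_right (smul_filQuot_eq_zero a N hr n) k _)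

theorem relLen_pow_smul_torM_ne_top (k n : ℕ) :
    relLen (Ideal.span (Set.range a) ^ n •
      (⊤ : Submodule R (torM R k (Fil a M 0) (Fil a N 0)))) ⊤ ≠ ⊤ := by
  exact relLen_pow_smul_ne_top hP n
    (fun _ hr => smul_torM_eq_zero_left k (smul_fil_eq_zero a M hr 0))
    (fun _ hr => smul_torM_eq_zero_right (smul_fil_eq_zero a N hr 0) k _)

variable [Finite ι]

theorem length_ker_torTower_p_ne_top (k m n : ℕ) :
    Module.length R (LinearMap.ker ((torTower a M N k).p m n)) ≠ ⊤ := by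
  refine length_ne_top_of_smul_eq_zero hP m (fun r hr x => Subtype.ext ?_)
    (fun r hr x => Subtype.ext (smul_torM_eq_zero_left k (smul_fil_eq_zero a M hr m) x.1))
    (fun r hr x => Subtype.ext (smul_torM_eq_zero_right (smul_fil_eq_zero a N hr n) k _ x.1))
  exact smul_eq_zero_of_torMap_left k (filTo a M m) (filMul a M hr) rfl x.2

theorem length_ker_torTower_q_ne_top (k m n : ℕ) :
    Module.length R (LinearMap.ker ((torTower a M N k).q m n)) ≠ ⊤ := by
  refine length_ne_top_of_smul_eq_zero hP n (fun r hr x => Subtype.ext ?_)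
    (fun r hr x => Subtype.ext (smul_torM_eq_zero_left k (smul_fil_eq_zero a M hr m) x.1))
    (fun r hr x => Subtype.ext (smul_torM_eq_zero_right (smul_fil_eq_zero a N hr n) k _ x.1))
  exact smul_eq_zero_of_torMap_right k (filTo a N n) (filMul a N hr) rfl x.2

theorem length_torM_filQuot_mem_eventuallyPoly (k : ℕ) :
    (fun n => ((Module.length R (torM R (k + 1) (FilQuot a M n) (FilQuot a N n))).toNat : ℚ)) ∈
      eventuallyPoly := by
  have h1 := (torSeq a M N k).relLen_range_mem_eventuallyPoly
    (relLen_pow_smul_torM_ne_top hP (k + 1)) (length_ker_torTower_p_ne_top hP k)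
  have h2 : (fun n => ((Module.length R (LinearMap.ker (torMap k
      (LinearMap.id : FilQuot a M n →ₗ[R] _) (filTo a N n)))).toNat : ℚ)) ∈ eventuallyPoly := by
    cases k with
    | zero =>
      refine eventuallyPoly_of_eq (eventuallyPoly_const 0) 0 fun n _ => ?_
      rw [Module.length_eq_zero]
      simp
    | succ k =>
      exact (torSeq a M N k).length_ker_mem_eventuallyPoly
        (relLen_pow_smul_torM_ne_top hP (k + 1)) (length_ker_torTower_p_ne_top hP k)
        (length_ker_torTower_q_ne_top hP (k + 1))
  refine eventuallyPoly_of_eq (eventuallyPoly.add_mem h1 h2) 0 fun n _ => ?_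
  have hne := length_torM_filQuot_ne_top hP (k + 1) n
  rw [length_torM_filQuot] at hne ⊢
  rw [ENat.toNat_add (fun h => hne (by rw [h, top_add])) (fun h => hne (by rw [h, add_top])),
    Nat.cast_add]
  rfl

end TorLength

theorem stmt2 (R : Type) [CommRing R] [IsNoetherianRing R] [IsLocalRing R]
    (I : Ideal R)
    (M : Type) [AddCommGroup M] [Module R M] [Module.Finite R M]
    (N : Type) [AddCommGroup N] [Module R N] [Module.Finite R N]
    (i : ℕ)
    (hprim : (I ⊔ Module.annihilator R M ⊔ Module.annihilator R N).radical
      = maximalIdeal R) :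
    ∃ (p : Polynomial ℚ) (n₀ : ℕ), ∀ n, n₀ ≤ n →
      ∃ c : ℕ,
        modLength R ↥(TorM R i (M ⧸ (I ^ n • (⊤ : Submodule R M)))
          (N ⧸ (I ^ n • (⊤ : Submodule R N)))) = (c : ℕ∞) ∧
        (c : ℚ) = Polynomial.eval (n : ℚ) p := by
  obtain ⟨S, hS⟩ : I.FG := IsNoetherian.noetherian I
  obtain ⟨a, rfl⟩ : ∃ a : S → R, Ideal.span (Set.range a) = I :=
    ⟨Subtype.val, by rw [← hS]; exact congrArg Ideal.span Subtype.range_coe⟩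
  obtain ⟨p, n₀, hp⟩ := length_torM_filQuot_mem_eventuallyPoly hprim.ge i
  refine ⟨p, n₀, fun n hn => ⟨_, ?_, hp n hn⟩⟩
  rw [ENat.natCast_toNat (length_torM_filQuot_ne_top hprim.ge (i + 1) n)]
  exact modLength_torM R _ _ i
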